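/- arXiv:0812.5023 — 2 statements merged into one kernel-verified Lean document; each statement's English description precedes it below -/
import Mathlib

section
/- Assume Q is hermitian. Let R_n = ⊕_{ν∈I^n} k[x_1,…,x_n]·1_ν, the commutative (possibly non-unital) k-algebra in which the 1_ν are orthogonal idempotents, with S_n acting by simultaneously permuting the variables x_1,…,x_n and the entries of ν, and let φ : R_n → H_n(Q) be the algebra homomorphism with φ(P(x_1,…,x_n)·1_ν) = P(x_{1,ν},…,x_{n,ν})·1_ν. Then φ is injective on the invariant subalgebra R_n^{S_n}, and φ(R_n^{S_n}) is exactly the center Z(H_n(Q)) = { z ∈ H_n(Q) : zh = hz for all h ∈ H_n(Q) }. -/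
open scoped BigOperators

namespace Rouq

variable {k : Type} [CommRing k] {I : Type} {n : ℕ}

/-- Generators of the algebra `H_n(Q)`: idempotents `1_ν`, polynomial generators
`x_{a,ν}` and intertwiners `τ_{i,ν}` (in 0-based indexing). -/
inductive Gen (I : Type) (n : ℕ) : Type
  | unit (ν : Fin n → I) : Gen I n
  | x (a : Fin n) (ν : Fin n → I) : Gen I n
  | tau (i : ℕ) (h : i + 1 < n) (ν : Fin n → I) : Gen I n

/-- The free (unital) algebra on the generators. -/
abbrev FA (k : Type) [CommRing k] (I : Type) (n : ℕ) := FreeAlgebra k (Gen I n)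

def E (k : Type) [CommRing k] (ν : Fin n → I) : FA k I n :=
  FreeAlgebra.ι k (Gen.unit ν)

def Xg (k : Type) [CommRing k] (a : Fin n) (ν : Fin n → I) : FA k I n :=
  FreeAlgebra.ι k (Gen.x a ν)

def Tg (k : Type) [CommRing k] (i : ℕ) (h : i + 1 < n) (ν : Fin n → I) : FA k I n :=
  FreeAlgebra.ι k (Gen.tau i h ν)

/-- `x_{a,ν}` with a natural-number index (junk value `0` when out of range). -/
def Xn (k : Type) [CommRing k] (a : ℕ) (ν : Fin n → I) : FA k I n :=
  if h : a < n then Xg k ⟨a, h⟩ ν else 0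

/-- `τ_{i,ν}` with a natural-number index (junk value `0` when out of range). -/
def Tn (k : Type) [CommRing k] (i : ℕ) (ν : Fin n → I) : FA k I n :=
  if h : i + 1 < n then Tg k i h ν else 0

/-- The action of the transposition `s_i = (i, i+1)` on sequences `ν ∈ I^n`. -/
def swapSeq (i : ℕ) (ν : Fin n → I) : Fin n → I :=
  if h : i + 1 < n then ν ∘ (Equiv.swap (⟨i, by omega⟩ : Fin n) ⟨i + 1, h⟩) else ν

/-- Evaluation of a polynomial `Q ∈ k[u,v]` at the pair `(a, b)`, localized at
the idempotent `u` (the constant term contributes a multiple of `u`). -/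
noncomputable def pev (Q : MvPolynomial (Fin 2) k) (a b u : FA k I n) : FA k I n :=
  ∑ m ∈ Q.support, Q.coeff m • (a ^ m 0 * b ^ m 1 * u)

/-- Evaluation of the divided difference
`(Q(xhi, xmid) - Q(xlo, xmid))/(xhi - xlo)`, localized at the idempotent `u`. -/
noncomputable def pevDiff (Q : MvPolynomial (Fin 2) k) (xlo xmid xhi u : FA k I n) :
    FA k I n :=
  ∑ m ∈ Q.support, Q.coeff m •
    ((∑ t ∈ Finset.range (m 0), xhi ^ t * xlo ^ (m 0 - 1 - t)) * xmid ^ m 1 * u)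

/-- The defining relations of `H_n(Q)`. -/
inductive Rel (Q : I → I → MvPolynomial (Fin 2) k) : FA k I n → FA k I n → Prop
  | unit_mul_self (ν : Fin n → I) :
      Rel Q (E k ν * E k ν) (E k ν)
  | unit_mul_ne (ν ν' : Fin n → I) (h : ν ≠ ν') :
      Rel Q (E k ν * E k ν') 0
  | tau_sandwich (i : ℕ) (h : i + 1 < n) (ν : Fin n → I) :
      Rel Q (Tg k i h ν) (E k (swapSeq i ν) * Tg k i h ν * E k ν)
  | x_sandwich (a : Fin n) (ν : Fin n → I) :
      Rel Q (Xg k a ν) (E k ν * Xg k a ν * E k ν)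
  | x_comm (a b : Fin n) (ν : Fin n → I) :
      Rel Q (Xg k a ν * Xg k b ν) (Xg k b ν * Xg k a ν)
  | tau_sq (i : ℕ) (h : i + 1 < n) (ν : Fin n → I) :
      Rel Q (Tg k i h (swapSeq i ν) * Tg k i h ν)
        (pev (Q (ν ⟨i, by omega⟩) (ν ⟨i + 1, h⟩)) (Xn k i ν) (Xn k (i + 1) ν) (E k ν))
  | tau_far (i j : ℕ) (hi : i + 1 < n) (hj : j + 1 < n) (hij : i + 2 ≤ j) (ν : Fin n → I) :
      Rel Q (Tg k i hi (swapSeq j ν) * Tg k j hj ν)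
        (Tg k j hj (swapSeq i ν) * Tg k i hi ν)
  | braid_eq (i : ℕ) (h : i + 2 < n) (ν : Fin n → I)
      (hv : ν ⟨i, by omega⟩ = ν ⟨i + 2, h⟩) :
      Rel Q
        (Tg k (i + 1) (by omega) (swapSeq i (swapSeq (i + 1) ν)) *
            Tg k i (by omega) (swapSeq (i + 1) ν) * Tg k (i + 1) (by omega) ν)
        (Tg k i (by omega) (swapSeq (i + 1) (swapSeq i ν)) *
            Tg k (i + 1) (by omega) (swapSeq i ν) * Tg k i (by omega) ν +
          pevDiff (Q (ν ⟨i, by omega⟩) (ν ⟨i + 1, by omega⟩))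
            (Xn k i ν) (Xn k (i + 1) ν) (Xn k (i + 2) ν) (E k ν))
  | braid_ne (i : ℕ) (h : i + 2 < n) (ν : Fin n → I)
      (hv : ν ⟨i, by omega⟩ ≠ ν ⟨i + 2, h⟩) :
      Rel Q
        (Tg k (i + 1) (by omega) (swapSeq i (swapSeq (i + 1) ν)) *
            Tg k i (by omega) (swapSeq (i + 1) ν) * Tg k (i + 1) (by omega) ν)
        (Tg k i (by omega) (swapSeq (i + 1) (swapSeq i ν)) *
            Tg k (i + 1) (by omega) (swapSeq i ν) * Tg k i (by omega) ν)
  | tau_x_i (i : ℕ) (h : i + 1 < n) (ν : Fin n → I)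
      (hv : ν ⟨i, by omega⟩ = ν ⟨i + 1, h⟩) :
      Rel Q (Tg k i h ν * Xn k i ν)
        (Xn k (i + 1) (swapSeq i ν) * Tg k i h ν - E k ν)
  | tau_x_i1 (i : ℕ) (h : i + 1 < n) (ν : Fin n → I)
      (hv : ν ⟨i, by omega⟩ = ν ⟨i + 1, h⟩) :
      Rel Q (Tg k i h ν * Xn k (i + 1) ν)
        (Xn k i (swapSeq i ν) * Tg k i h ν + E k ν)
  | tau_x_other (i : ℕ) (h : i + 1 < n) (a : Fin n) (ν : Fin n → I)
      (hv : (a.val ≠ i ∧ a.val ≠ i + 1) ∨ ν ⟨i, by omega⟩ ≠ ν ⟨i + 1, h⟩) :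
      Rel Q (Tg k i h ν * Xg k a ν)
        (Xg k (Equiv.swap (⟨i, by omega⟩ : Fin n) ⟨i + 1, h⟩ a) (swapSeq i ν) * Tg k i h ν)

/-- The algebra `H_n(Q)`, as a quotient of the free algebra by the defining
relations. -/
abbrev HQ (k : Type) [CommRing k] (I : Type) (n : ℕ)
    (Q : I → I → MvPolynomial (Fin 2) k) :=
  RingQuot (Rel (k := k) (I := I) (n := n) Q)

/-- The quotient map. -/
noncomputable def mk (Q : I → I → MvPolynomial (Fin 2) k) : FA k I n →ₐ[k] HQ k I n Q :=
  RingQuot.mkAlgHom k (Rel Q)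

/-- `Q` is hermitian: `Q_{ij}(u,v) = Q_{ji}(v,u)`. -/
def Hermitian (Q : I → I → MvPolynomial (Fin 2) k) : Prop :=
  ∀ i j, Q i j = MvPolynomial.rename (Equiv.swap (0 : Fin 2) 1) (Q j i)

/-- The (possibly non-unital) algebra `H_n(Q)` proper: the non-unital subalgebra
of the presented algebra generated by the generators. -/
noncomputable def Hgen (Q : I → I → MvPolynomial (Fin 2) k) :
    NonUnitalSubalgebra k (HQ k I n Q) :=
  NonUnitalAlgebra.adjoin k (Set.range fun g : Gen I n => mk Q (FreeAlgebra.ι k g))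

/-- The permutation of `Fin n` given by a word in the Coxeter generators. -/
def permOfWord (n : ℕ) (l : List ℕ) : Equiv.Perm (Fin n) :=
  (l.map fun i =>
    if h : i + 1 < n then Equiv.swap (⟨i, by omega⟩ : Fin n) ⟨i + 1, h⟩ else 1).prod

/-- `l` is a reduced word for the permutation `w`. -/
def IsReducedWordFor (n : ℕ) (l : List ℕ) (w : Equiv.Perm (Fin n)) : Prop :=
  (∀ i ∈ l, i + 1 < n) ∧ permOfWord n l = w ∧
    ∀ l' : List ℕ, (∀ i ∈ l', i + 1 < n) → permOfWord n l' = w → l.length ≤ l'.length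

/-- Action of a word of simple transpositions on a sequence. -/
def seqActWord : List ℕ → (Fin n → I) → (Fin n → I)
  | [], ν => ν
  | i :: l, ν => swapSeq i (seqActWord l ν)

/-- `τ_{i_1, s_{i_2}⋯s_{i_r}(ν)} ⋯ τ_{i_{r-1}, s_{i_r}(ν)} τ_{i_r, ν}` for a word
`l = [i_1, …, i_r]`; the empty word gives the idempotent `1_ν`. -/
noncomputable def tauWord (k : Type) [CommRing k] : List ℕ → (Fin n → I) → FA k I n
  | [], ν => E k ν
  | i :: l, ν => Tn k i (seqActWord l ν) * tauWord k l ν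

/-- The standard reduced word for the longest element of `S_m` (0-based). -/
def longWord (m : ℕ) : List ℕ :=
  (List.range m).foldr (fun j acc => (List.range j).reverse ++ acc) []

end Rouq

namespace Rouq

variable {k : Type} [CommRing k] {I : Type} {n : ℕ}

/-- `f ∈ R_n = ⊕_ν k[x_1,…,x_n] 1_ν` is invariant under the simultaneous action
of `S_n` on the variables and on the sequence `ν`. -/
def SymInvariant (f : (Fin n → I) →₀ MvPolynomial (Fin n) k) : Prop :=
  ∀ (σ : Equiv.Perm (Fin n)) (μ : Fin n → I),
    MvPolynomial.rename σ (f (μ ∘ σ)) = f μ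

/-- The image of `P(x_1,…,x_n)·1_ν` under `φ : R_n → H_n(Q)`. -/
noncomputable def phiNu (Q : I → I → MvPolynomial (Fin 2) k) (ν : Fin n → I)
    (P : MvPolynomial (Fin n) k) : HQ k I n Q :=
  mk Q (∑ m ∈ P.support, P.coeff m •
    ((List.ofFn fun a : Fin n => Xg k a ν ^ m a).prod * E k ν))

/-- The homomorphism `φ : R_n → H_n(Q)`. -/
noncomputable def Phi (Q : I → I → MvPolynomial (Fin 2) k)
    (f : (Fin n → I) →₀ MvPolynomial (Fin n) k) : HQ k I n Q :=
  f.sum fun ν P => phiNu Q ν P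

end Rouq

namespace Rouq

open MvPolynomial

variable {k : Type} [CommRing k] {I : Type} {n : ℕ} (Q : I → I → MvPolynomial (Fin 2) k)

/-- The simple transposition `s_i` of `Fin n` (the identity when out of range). -/
def adj (n i : ℕ) : Equiv.Perm (Fin n) :=
  if h : i + 1 < n then Equiv.swap (⟨i, by omega⟩ : Fin n) ⟨i + 1, h⟩ else 1

theorem adj_of_lt {i : ℕ} (h : i + 1 < n) :
    adj n i = Equiv.swap (⟨i, by omega⟩ : Fin n) ⟨i + 1, h⟩ := dif_pos h

theorem adj_adj (i : ℕ) (a : Fin n) : adj n i (adj n i a) = a := by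
  unfold adj; split_ifs <;> simp

theorem swapSeq_eq (i : ℕ) (ν : Fin n → I) : swapSeq i ν = ν ∘ adj n i := by
  unfold swapSeq adj; split_ifs <;> rfl

theorem swapSeq_swapSeq (i : ℕ) (ν : Fin n → I) : swapSeq i (swapSeq i ν) = ν := by
  funext a; simp [swapSeq_eq, adj_adj]

theorem swapSeq_of_eq {i : ℕ} (h : i + 1 < n) {ν : Fin n → I}
    (hv : ν ⟨i, by omega⟩ = ν ⟨i + 1, h⟩) : swapSeq i ν = ν := by
  funext a
  rw [swapSeq_eq, adj_of_lt h, Function.comp_apply]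
  by_cases h1 : a = ⟨i, by omega⟩
  · subst h1; simp [hv]
  · by_cases h2 : a = ⟨i + 1, h⟩
    · subst h2; simp [hv]
    · rw [Equiv.swap_apply_of_ne_of_ne h1 h2]

/-- The idempotent `1_ν` of `H_n(Q)`. -/
noncomputable def hE (ν : Fin n → I) : HQ k I n Q := mk Q (E k ν)

/-- The generator `x_{a,ν}` of `H_n(Q)`. -/
noncomputable def hX (a : Fin n) (ν : Fin n → I) : HQ k I n Q := mk Q (Xg k a ν)

/-- The generator `τ_{i,ν}` of `H_n(Q)` (zero when `i` is out of range). -/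
noncomputable def hT (i : ℕ) (ν : Fin n → I) : HQ k I n Q := mk Q (Tn k i ν)

/-- The product of generators `τ` along a word, starting at `1_ν`. -/
noncomputable def hW (l : List ℕ) (ν : Fin n → I) : HQ k I n Q := mk Q (tauWord k l ν)

variable {Q}

theorem mk_rel {a b : FA k I n} (h : Rel Q a b) : mk Q a = mk Q b :=
  RingQuot.mkAlgHom_rel k h

theorem hT_of_lt {i : ℕ} (h : i + 1 < n) (ν : Fin n → I) : hT Q i ν = mk Q (Tg k i h ν) := by
  rw [hT, Tn, dif_pos h]

theorem hT_of_not_lt {i : ℕ} (h : ¬ i + 1 < n) (ν : Fin n → I) : hT Q i ν = 0 := by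
  rw [hT, Tn, dif_neg h, map_zero]

theorem hE_mul_self (ν : Fin n → I) : hE Q ν * hE Q ν = hE Q ν := by
  simpa [hE] using mk_rel (Rel.unit_mul_self (Q := Q) ν)

theorem hE_mul_ne {ν μ : Fin n → I} (h : ν ≠ μ) : hE Q ν * hE Q μ = 0 := by
  simpa [hE] using mk_rel (Rel.unit_mul_ne (Q := Q) ν μ h)

theorem hX_sandwich (a : Fin n) (ν : Fin n → I) : hX Q a ν = hE Q ν * hX Q a ν * hE Q ν := by
  simpa [hE, hX] using mk_rel (Rel.x_sandwich (Q := Q) a ν)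

theorem hX_mul_hE (a : Fin n) (ν : Fin n → I) : hX Q a ν * hE Q ν = hX Q a ν := by
  rw [hX_sandwich, mul_assoc _ _ (hE Q ν), hE_mul_self]

theorem hE_mul_hX (a : Fin n) (ν : Fin n → I) : hE Q ν * hX Q a ν = hX Q a ν := by
  rw [hX_sandwich, ← mul_assoc, ← mul_assoc, hE_mul_self]

theorem hX_comm (a b : Fin n) (ν : Fin n → I) : hX Q a ν * hX Q b ν = hX Q b ν * hX Q a ν := by
  simpa [hX] using mk_rel (Rel.x_comm (Q := Q) a b ν)

theorem hT_sandwich (i : ℕ) (ν : Fin n → I) :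
    hT Q i ν = hE Q (swapSeq i ν) * hT Q i ν * hE Q ν := by
  by_cases h : i + 1 < n
  · simpa [hE, hT_of_lt h] using mk_rel (Rel.tau_sandwich (Q := Q) i h ν)
  · simp [hT_of_not_lt h]

theorem hT_mul_hE (i : ℕ) (ν : Fin n → I) : hT Q i ν * hE Q ν = hT Q i ν := by
  rw [hT_sandwich, mul_assoc _ _ (hE Q ν), hE_mul_self]

theorem hE_mul_hT (i : ℕ) (ν : Fin n → I) : hE Q (swapSeq i ν) * hT Q i ν = hT Q i ν := by
  rw [hT_sandwich, ← mul_assoc, ← mul_assoc, hE_mul_self]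

theorem mk_Xn {i : ℕ} (h : i < n) (ν : Fin n → I) : mk Q (Xn k i ν) = hX Q ⟨i, h⟩ ν := by
  rw [hX, Xn, dif_pos h]

open scoped IsMulCommutative in
theorem exists_polyHom (Q : I → I → MvPolynomial (Fin 2) k) (ν : Fin n → I) :
    ∃ Ψ : MvPolynomial (Fin n) k →ₐ[k] HQ k I n Q, ∀ a, Ψ (X a) = hX Q a ν := by
  have : IsMulCommutative (Algebra.adjoin k (Set.range fun a => hX Q a ν)) :=
    Algebra.isMulCommutative_adjoin k (by
      rintro _ ⟨a, rfl⟩ _ ⟨b, rfl⟩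
      exact hX_comm a b ν)
  refine ⟨(Algebra.adjoin k (Set.range fun a => hX Q a ν)).val.comp
    (aeval (S₁ := Algebra.adjoin k (Set.range fun a => hX Q a ν))
      fun a => ⟨hX Q a ν, Algebra.subset_adjoin ⟨a, rfl⟩⟩), fun a => ?_⟩
  simp

/-- Evaluation of polynomials at the commuting elements `x_{a,ν}`. -/
noncomputable def polyHom (Q : I → I → MvPolynomial (Fin 2) k) (ν : Fin n → I) :
    MvPolynomial (Fin n) k →ₐ[k] HQ k I n Q := (exists_polyHom Q ν).choose

@[simp] theorem polyHom_X (ν : Fin n → I) (a : Fin n) : polyHom Q ν (X a) = hX Q a ν :=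
  (exists_polyHom Q ν).choose_spec a

theorem phiNu_eq (ν : Fin n → I) (P : MvPolynomial (Fin n) k) :
    phiNu Q ν P = polyHom Q ν P * hE Q ν := by
  conv_rhs => rw [P.as_sum]
  rw [phiNu, map_sum, map_sum, Finset.sum_mul]
  refine Finset.sum_congr rfl fun m _ => ?_
  have h : monomial m (coeff m P) =
      coeff m P • (List.ofFn fun a : Fin n => (X a : MvPolynomial (Fin n) k) ^ m a).prod := by
    rw [List.prod_ofFn, monomial_eq, Finsupp.prod_fintype _ _ (by simp), smul_eq_C_mul]
  rw [h, map_smul, map_smul, map_mul, map_list_prod, map_list_prod, List.map_ofFn, List.map_ofFn,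
    smul_mul_assoc]
  congr 4
  funext a
  simp [hX]

theorem polyHom_comm (ν : Fin n → I) (P : MvPolynomial (Fin n) k) :
    polyHom Q ν P * hE Q ν = hE Q ν * polyHom Q ν P := by
  induction P using MvPolynomial.induction_on with
  | C a =>
    rw [← algebraMap_eq, AlgHom.commutes, Algebra.commutes]
  | add p q hp hq => rw [map_add, add_mul, mul_add, hp, hq]
  | mul_X p a hp =>
    rw [map_mul, polyHom_X, mul_assoc, hX_mul_hE, ← mul_assoc, ← hp, mul_assoc, hE_mul_hX]

theorem phiNu_add (ν : Fin n → I) (P R : MvPolynomial (Fin n) k) :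
    phiNu Q ν (P + R) = phiNu Q ν P + phiNu Q ν R := by
  simp only [phiNu_eq, map_add, add_mul]

theorem phiNu_sub (ν : Fin n → I) (P R : MvPolynomial (Fin n) k) :
    phiNu Q ν (P - R) = phiNu Q ν P - phiNu Q ν R := by
  simp only [phiNu_eq, map_sub, sub_mul]

@[simp] theorem phiNu_zero (ν : Fin n → I) : phiNu Q ν 0 = 0 := by
  simp [phiNu_eq]

theorem phiNu_smul (ν : Fin n → I) (c : k) (P : MvPolynomial (Fin n) k) :
    phiNu Q ν (c • P) = c • phiNu Q ν P := by
  simp only [phiNu_eq, map_smul, smul_mul_assoc]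

@[simp] theorem phiNu_one (ν : Fin n → I) : phiNu Q ν 1 = hE Q ν := by
  simp [phiNu_eq]

@[simp] theorem phiNu_X (ν : Fin n → I) (a : Fin n) : phiNu Q ν (X a) = hX Q a ν := by
  simp [phiNu_eq, hX_mul_hE]

theorem phiNu_mul (ν : Fin n → I) (P R : MvPolynomial (Fin n) k) :
    phiNu Q ν (P * R) = phiNu Q ν P * phiNu Q ν R := by
  simp only [phiNu_eq, map_mul]
  rw [mul_assoc (polyHom Q ν P) (hE Q ν), ← mul_assoc (hE Q ν), ← polyHom_comm,
    mul_assoc (polyHom Q ν R), hE_mul_self, mul_assoc]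

theorem hE_mul_phiNu (ν : Fin n → I) (P : MvPolynomial (Fin n) k) :
    hE Q ν * phiNu Q ν P = phiNu Q ν P := by
  rw [← phiNu_one, ← phiNu_mul, one_mul]

theorem phiNu_mul_hE (ν : Fin n → I) (P : MvPolynomial (Fin n) k) :
    phiNu Q ν P * hE Q ν = phiNu Q ν P := by
  rw [← phiNu_one, ← phiNu_mul, mul_one]

theorem hE_mul_phiNu_ne {ν μ : Fin n → I} (h : μ ≠ ν) (P : MvPolynomial (Fin n) k) :
    hE Q μ * phiNu Q ν P = 0 := by
  rw [← hE_mul_phiNu, ← mul_assoc, hE_mul_ne h, zero_mul]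

theorem phiNu_mul_hE_ne {ν μ : Fin n → I} (h : ν ≠ μ) (P : MvPolynomial (Fin n) k) :
    phiNu Q ν P * hE Q μ = 0 := by
  rw [← phiNu_mul_hE, mul_assoc, hE_mul_ne h, mul_zero]

theorem mk_pev (R : MvPolynomial (Fin 2) k) {i j : ℕ} (hi : i < n) (hj : j < n) (ν : Fin n → I) :
    ∃ D, mk Q (pev R (Xn k i ν) (Xn k j ν) (E k ν)) = phiNu Q ν D := by
  refine ⟨∑ m ∈ R.support, R.coeff m • (X ⟨i, hi⟩ ^ m 0 * X ⟨j, hj⟩ ^ m 1), ?_⟩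
  rw [pev, phiNu_eq, map_sum, map_sum, Finset.sum_mul]
  refine Finset.sum_congr rfl fun m _ => ?_
  simp [mk_Xn hi, mk_Xn hj, hE]

theorem mk_pevDiff (R : MvPolynomial (Fin 2) k) {i j l : ℕ} (hi : i < n) (hj : j < n) (hl : l < n)
    (ν : Fin n → I) :
    ∃ D, mk Q (pevDiff R (Xn k i ν) (Xn k j ν) (Xn k l ν) (E k ν)) = phiNu Q ν D := by
  refine ⟨∑ m ∈ R.support, R.coeff m • ((∑ t ∈ Finset.range (m 0),
    X ⟨l, hl⟩ ^ t * X ⟨i, hi⟩ ^ (m 0 - 1 - t)) * X ⟨j, hj⟩ ^ m 1), ?_⟩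
  rw [pevDiff, phiNu_eq, map_sum, map_sum, Finset.sum_mul]
  refine Finset.sum_congr rfl fun m _ => ?_
  simp [mk_Xn hi, mk_Xn hj, mk_Xn hl, hE]

/-- Straightening of `τ_{i,ν}` against polynomials, with a divided-difference correction `D`. -/
theorem hT_mul_phiNu {i : ℕ} (h : i + 1 < n) (ν : Fin n → I) (P : MvPolynomial (Fin n) k) :
    ∃ D, hT Q i ν * phiNu Q ν P =
        phiNu Q (swapSeq i ν) (rename (adj n i) P) * hT Q i ν + phiNu Q ν D ∧
      (ν ⟨i, by omega⟩ ≠ ν ⟨i + 1, h⟩ → D = 0) ∧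
      (ν ⟨i, by omega⟩ = ν ⟨i + 1, h⟩ →
        (X ⟨i, by omega⟩ - X ⟨i + 1, h⟩) * D = rename (adj n i) P - P) := by
  have base : ∀ a : Fin n, ∃ D, hT Q i ν * hX Q a ν =
        hX Q (adj n i a) (swapSeq i ν) * hT Q i ν + phiNu Q ν D ∧
      (ν ⟨i, by omega⟩ ≠ ν ⟨i + 1, h⟩ → D = 0) ∧
      (ν ⟨i, by omega⟩ = ν ⟨i + 1, h⟩ →
        (X ⟨i, by omega⟩ - X ⟨i + 1, h⟩) * D = X (adj n i a) - X a) := by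
    intro a
    by_cases hv : (a.val ≠ i ∧ a.val ≠ i + 1) ∨ ν ⟨i, by omega⟩ ≠ ν ⟨i + 1, h⟩
    · refine ⟨0, ?_, fun _ => rfl, fun hne => ?_⟩
      · have := mk_rel (Rel.tau_x_other (Q := Q) i h a ν hv)
        rw [phiNu_zero, add_zero, hT_of_lt h, adj_of_lt h]
        simpa [hX] using this
      · obtain ⟨h1, h2⟩ := hv.resolve_right (not_not.mpr hne)
        rw [adj_of_lt h, Equiv.swap_apply_of_ne_of_ne (fun e => h1 (by rw [e]))
          (fun e => h2 (by rw [e]))]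
        ring
    · push Not at hv
      obtain ⟨h1, hν⟩ := hv
      by_cases ha : a.val = i
      · rw [show a = ⟨i, by omega⟩ from Fin.ext ha]
        refine ⟨-1, ?_, fun hne => (hne hν).elim, fun _ => ?_⟩
        · have := mk_rel (Rel.tau_x_i (Q := Q) i h ν hν)
          rw [map_mul, map_sub, map_mul, mk_Xn (by omega), mk_Xn h, ← hT_of_lt h] at this
          rw [this, adj_of_lt h, Equiv.swap_apply_left, ← zero_sub 1, phiNu_sub, phiNu_zero,
            phiNu_one, zero_sub, sub_eq_add_neg]
          rfl
        · rw [adj_of_lt h, Equiv.swap_apply_left]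
          ring
      · obtain rfl : a = ⟨i + 1, h⟩ := Fin.ext (h1 ha)
        refine ⟨1, ?_, fun hne => (hne hν).elim, fun _ => ?_⟩
        · have := mk_rel (Rel.tau_x_i1 (Q := Q) i h ν hν)
          rw [map_mul, map_add, map_mul, mk_Xn h, mk_Xn (i := i) (by omega), ← hT_of_lt h] at this
          rw [this, adj_of_lt h, Equiv.swap_apply_right, phiNu_one]
          rfl
        · rw [adj_of_lt h, Equiv.swap_apply_right]
          ring
  induction P using MvPolynomial.induction_on with
  | C c =>
    refine ⟨0, ?_, fun _ => rfl, fun _ => by simp⟩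
    have hC : ∀ μ : Fin n → I, phiNu Q μ (C c) = c • hE Q μ := fun μ => by
      rw [← mul_one (C c), ← smul_eq_C_mul, phiNu_smul, phiNu_one]
    rw [rename_C, hC, hC, phiNu_zero, add_zero, mul_smul_comm, hT_mul_hE, smul_mul_assoc, hE_mul_hT]
  | add p q hp hq =>
    obtain ⟨D, h1, h2, h3⟩ := hp
    obtain ⟨D', h1', h2', h3'⟩ := hq
    refine ⟨D + D', ?_, fun hne => by rw [h2 hne, h2' hne, add_zero], fun he => ?_⟩
    · rw [phiNu_add, mul_add, h1, h1', map_add, phiNu_add, phiNu_add, add_mul]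
      abel
    · rw [mul_add, h3 he, h3' he, map_add]
      ring
  | mul_X p a hp =>
    obtain ⟨D, h1, h2, h3⟩ := hp
    obtain ⟨D', h1', h2', h3'⟩ := base a
    refine ⟨rename (adj n i) p * D' + D * X a, ?_, fun hne => by rw [h2 hne, h2' hne]; ring,
      fun he => ?_⟩
    · by_cases hν : ν ⟨i, by omega⟩ = ν ⟨i + 1, h⟩
      · have hs := swapSeq_of_eq h hν
        rw [hs] at h1 h1' ⊢
        rw [phiNu_mul, ← mul_assoc, h1, add_mul, mul_assoc, phiNu_X, h1', map_mul, rename_X,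
          phiNu_mul, phiNu_X, phiNu_add, phiNu_mul, phiNu_mul, phiNu_X, mul_add, mul_assoc]
        abel
      · rw [phiNu_mul, ← mul_assoc, h1, add_mul, mul_assoc, phiNu_X, h1', h2 hν, h2' hν, map_mul,
          rename_X, phiNu_mul, phiNu_X]
        simp [mul_assoc]
    · rw [map_mul, rename_X]
      linear_combination rename (adj n i) p * h3' he + X a * h3 he

end Rouq

namespace Rouq

open MvPolynomial

variable {k : Type} [CommRing k] {I : Type} {n : ℕ} {Q : I → I → MvPolynomial (Fin 2) k}

@[simp] theorem hW_nil (ν : Fin n → I) : hW Q [] ν = hE Q ν := rfl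

@[simp] theorem hW_cons (i : ℕ) (l : List ℕ) (ν : Fin n → I) :
    hW Q (i :: l) ν = hT Q i (seqActWord l ν) * hW Q l ν := by
  simp [hW, hT, tauWord]

theorem seqActWord_append (u v : List ℕ) (ν : Fin n → I) :
    seqActWord (u ++ v) ν = seqActWord u (seqActWord v ν) := by
  induction u with
  | nil => rfl
  | cons i u ih => simp [seqActWord, ih]

theorem hE_mul_hW (l : List ℕ) (ν : Fin n → I) : hE Q (seqActWord l ν) * hW Q l ν = hW Q l ν := by
  cases l with
  | nil => exact hE_mul_self ν
  | cons i l => rw [hW_cons, seqActWord, ← mul_assoc, hE_mul_hT]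

theorem hW_append (u v : List ℕ) (ν : Fin n → I) :
    hW Q (u ++ v) ν = hW Q u (seqActWord v ν) * hW Q v ν := by
  induction u with
  | nil => simp [hE_mul_hW]
  | cons i u ih => simp [ih, seqActWord_append, mul_assoc]

theorem hE_mul_hW_ne {l : List ℕ} {ν μ : Fin n → I} (h : μ ≠ seqActWord l ν) :
    hE Q μ * hW Q l ν = 0 := by
  rw [← hE_mul_hW, ← mul_assoc, hE_mul_ne h, zero_mul]

theorem hT_mul_hW_ne {i : ℕ} {l : List ℕ} {ν μ : Fin n → I} (h : μ ≠ seqActWord l ν) :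
    hT Q i μ * hW Q l ν = 0 := by
  rw [← hT_mul_hE, mul_assoc, hE_mul_hW_ne h, mul_zero]

theorem phiNu_mul_hW_ne {l : List ℕ} {ν μ : Fin n → I} (h : μ ≠ seqActWord l ν)
    (P : MvPolynomial (Fin n) k) : phiNu Q μ P * hW Q l ν = 0 := by
  rw [← phiNu_mul_hE, mul_assoc, hE_mul_hW_ne h, mul_zero]

variable (Q) in
/-- The span of the elements `τ_l φ(P) 1_ν` with `l` a word of length less than `d`. -/
noncomputable def wordFil (ν : Fin n → I) (d : ℕ) : Submodule k (HQ k I n Q) :=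
  Submodule.span k {y | ∃ (l : List ℕ) (P : MvPolynomial (Fin n) k),
    l.length < d ∧ y = hW Q l ν * phiNu Q ν P}

theorem mem_wordFil {ν : Fin n → I} {d : ℕ} {l : List ℕ} (h : l.length < d)
    (P : MvPolynomial (Fin n) k) : hW Q l ν * phiNu Q ν P ∈ wordFil Q ν d :=
  Submodule.subset_span ⟨l, P, h, rfl⟩

theorem hW_mul_hE (l : List ℕ) (ν : Fin n → I) : hW Q l ν * hE Q ν = hW Q l ν := by
  induction l with
  | nil => exact hE_mul_self ν
  | cons i l ih => rw [hW_cons, mul_assoc, ih]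

theorem wordFil_mono {ν : Fin n → I} {d d' : ℕ} (h : d ≤ d') : wordFil Q ν d ≤ wordFil Q ν d' :=
  Submodule.span_mono fun _ ⟨l, P, hl, hy⟩ => ⟨l, P, hl.trans_le h, hy⟩

theorem mul_mem_of_forall_generator {S T : Submodule k (HQ k I n Q)} {s : Set (HQ k I n Q)}
    (hS : S = Submodule.span k s) {h : HQ k I n Q} (hs : ∀ y ∈ s, h * y ∈ T) {y : HQ k I n Q}
    (hy : y ∈ S) : h * y ∈ T := by
  have : S ≤ T.comap (LinearMap.mulLeft k h) := by
    rw [hS, Submodule.span_le]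
    exact hs
  exact this hy

theorem hT_mul_mem_wordFil {ν : Fin n → I} {d : ℕ} (i : ℕ) (μ : Fin n → I) {y : HQ k I n Q}
    (hy : y ∈ wordFil Q ν d) : hT Q i μ * y ∈ wordFil Q ν (d + 1) := by
  refine mul_mem_of_forall_generator rfl ?_ hy
  rintro _ ⟨l, P, hl, rfl⟩
  rw [← mul_assoc]
  by_cases h : μ = seqActWord l ν
  · rw [h, ← hW_cons]
    exact mem_wordFil (by simpa using hl) P
  · rw [hT_mul_hW_ne h, zero_mul]
    exact zero_mem _

theorem hW_mul_mem_wordFil {ν : Fin n → I} {d : ℕ} (u : List ℕ) (μ : Fin n → I) {y : HQ k I n Q}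
    (hy : y ∈ wordFil Q ν d) : hW Q u μ * y ∈ wordFil Q ν (d + u.length) := by
  refine mul_mem_of_forall_generator rfl ?_ hy
  rintro _ ⟨l, P, hl, rfl⟩
  rw [← mul_assoc]
  by_cases h : μ = seqActWord l ν
  · rw [h, ← hW_append]
    exact mem_wordFil (by simp; omega) P
  · rw [← hW_mul_hE u μ, mul_assoc (hW Q u μ), hE_mul_hW_ne h, mul_zero, zero_mul]
    exact zero_mem _

theorem mul_phiNu_mem_wordFil {ν : Fin n → I} {d : ℕ} (P : MvPolynomial (Fin n) k)
    {y : HQ k I n Q} (hy : y ∈ wordFil Q ν d) : y * phiNu Q ν P ∈ wordFil Q ν d := by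
  have : wordFil Q ν d ≤ (wordFil Q ν d).comap (LinearMap.mulRight k (phiNu Q ν P)) := by
    conv_lhs => rw [wordFil]
    rw [Submodule.span_le]
    rintro _ ⟨l, R, hl, rfl⟩
    simpa [mul_assoc, ← phiNu_mul] using mem_wordFil hl (R * P)
  exact this hy

theorem rename_adj_adj (i : ℕ) (P : MvPolynomial (Fin n) k) :
    rename (adj n i) (rename (adj n i) P) = P := by
  rw [rename_rename]
  convert rename_id_apply P
  funext a
  exact adj_adj i a

theorem phiNu_mul_hW_mem_wordFil (ν μ : Fin n → I) (l : List ℕ) (P : MvPolynomial (Fin n) k) :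
    phiNu Q μ P * hW Q l ν ∈ wordFil Q ν (l.length + 1) := by
  induction l generalizing μ P with
  | nil =>
    by_cases h : μ = ν
    · subst h
      simpa [phiNu_mul_hE, hE_mul_phiNu] using mem_wordFil (Q := Q) (ν := μ) (l := []) (d := 1)
        (by simp) P
    · rw [hW_nil, phiNu_mul_hE_ne h]
      exact zero_mem _
  | cons i l ih =>
    by_cases h : μ = seqActWord (i :: l) ν
    · by_cases hi : i + 1 < n
      · obtain ⟨D, hD, -⟩ := hT_mul_phiNu (Q := Q) hi (seqActWord l ν) (rename (adj n i) P)
        rw [rename_adj_adj] at hD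
        have : phiNu Q μ P * hW Q (i :: l) ν =
            hT Q i (seqActWord l ν) * (phiNu Q (seqActWord l ν) (rename (adj n i) P) * hW Q l ν) -
              phiNu Q (seqActWord l ν) D * hW Q l ν := by
          rw [← mul_assoc, hD, add_mul, add_sub_cancel_right, h, hW_cons, seqActWord, mul_assoc]
        rw [this]
        exact sub_mem (hT_mul_mem_wordFil _ _ (ih _ _)) (wordFil_mono (by simp) (ih _ _))
      · rw [hW_cons, hT_of_not_lt hi, zero_mul, mul_zero]
        exact zero_mem _
    · rw [phiNu_mul_hW_ne h]
      exact zero_mem _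

theorem hW_mul_phiNu_mul_hW_mem_wordFil (ν μ μ' : Fin n → I) (u v : List ℕ)
    (P : MvPolynomial (Fin n) k) :
    hW Q u μ' * (phiNu Q μ P * hW Q v ν) ∈ wordFil Q ν (u.length + v.length + 1) :=
  wordFil_mono (by omega) (hW_mul_mem_wordFil u μ' (phiNu_mul_hW_mem_wordFil ν μ v P))

/-- Braid moves on words. -/
inductive Move (n : ℕ) : List ℕ → List ℕ → Prop
  | far (u v : List ℕ) (i j : ℕ) (hi : i + 1 < n) (hj : j + 1 < n) (hij : i + 2 ≤ j) :
      Move n (u ++ ([i, j] ++ v)) (u ++ ([j, i] ++ v))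
  | far' (u v : List ℕ) (i j : ℕ) (hi : i + 1 < n) (hj : j + 1 < n) (hij : i + 2 ≤ j) :
      Move n (u ++ ([j, i] ++ v)) (u ++ ([i, j] ++ v))
  | braid (u v : List ℕ) (i : ℕ) (h : i + 2 < n) :
      Move n (u ++ ([i + 1, i, i + 1] ++ v)) (u ++ ([i, i + 1, i] ++ v))

theorem Move.length_eq {l l' : List ℕ} (h : Move n l l') : l.length = l'.length := by
  cases h <;> simp

theorem Move.append_left (w : List ℕ) {l l' : List ℕ} (h : Move n l l') :
    Move n (w ++ l) (w ++ l') := by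
  cases h with
  | far u v i j hi hj hij => simpa using Move.far (w ++ u) v i j hi hj hij
  | far' u v i j hi hj hij => simpa using Move.far' (w ++ u) v i j hi hj hij
  | braid u v i h => simpa using Move.braid (w ++ u) v i h

theorem adj_apply_ne {i : ℕ} {a : Fin n} (h1 : a.val ≠ i) (h2 : a.val ≠ i + 1) :
    adj n i a = a := by
  unfold adj
  split_ifs
  · exact Equiv.swap_apply_of_ne_of_ne (fun e => h1 (by rw [e])) (fun e => h2 (by rw [e]))
  · rfl

theorem adj_apply_val {i : ℕ} (hi : i + 1 < n) (a : Fin n) :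
    (adj n i a).val = if a.val = i then i + 1 else if a.val = i + 1 then i else a.val := by
  rw [adj_of_lt hi, Equiv.swap_apply_def]
  simp only [Fin.ext_iff]
  split_ifs <;> rfl

theorem swapSeq_far {i j : ℕ} (hi : i + 1 < n) (hj : j + 1 < n) (hij : i + 2 ≤ j)
    (ν : Fin n → I) : swapSeq i (swapSeq j ν) = swapSeq j (swapSeq i ν) := by
  funext a
  simp only [swapSeq_eq, Function.comp_apply]
  congr 1
  ext
  simp only [adj_apply_val hi, adj_apply_val hj]
  split_ifs <;> omega

theorem swapSeq_braid {i : ℕ} (h : i + 2 < n) (ν : Fin n → I) :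
    swapSeq (i + 1) (swapSeq i (swapSeq (i + 1) ν)) = swapSeq i (swapSeq (i + 1) (swapSeq i ν)) := by
  funext a
  simp only [swapSeq_eq, Function.comp_apply]
  congr 1
  ext
  simp only [adj_apply_val (show i + 1 < n by omega), adj_apply_val (show i + 1 + 1 < n by omega)]
  split_ifs <;> omega

theorem hT_far {i j : ℕ} (hi : i + 1 < n) (hj : j + 1 < n) (hij : i + 2 ≤ j) (ν : Fin n → I) :
    hT Q i (swapSeq j ν) * hT Q j ν = hT Q j (swapSeq i ν) * hT Q i ν := by
  have := mk_rel (Rel.tau_far (Q := Q) i j hi hj hij ν)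
  simpa [hT_of_lt hi, hT_of_lt hj] using this

theorem hT_braid {i : ℕ} (h : i + 2 < n) (ν : Fin n → I) : ∃ D,
    hT Q (i + 1) (swapSeq i (swapSeq (i + 1) ν)) * hT Q i (swapSeq (i + 1) ν) * hT Q (i + 1) ν =
      hT Q i (swapSeq (i + 1) (swapSeq i ν)) * hT Q (i + 1) (swapSeq i ν) * hT Q i ν +
        phiNu Q ν D := by
  have h1 : i + 1 < n := by omega
  have h2 : i + 1 + 1 < n := by omega
  by_cases hv : ν ⟨i, by omega⟩ = ν ⟨i + 2, h⟩
  · obtain ⟨D, hD⟩ := mk_pevDiff (Q (ν ⟨i, by omega⟩) (ν ⟨i + 1, by omega⟩)) (i := i) (j := i + 1)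
      (l := i + 2) (by omega) h1 h2 ν (Q := Q)
    refine ⟨D, ?_⟩
    have := mk_rel (Rel.braid_eq (Q := Q) i h ν hv)
    rw [map_add, hD] at this
    simpa [hT_of_lt h1, hT_of_lt h2] using this
  · refine ⟨0, ?_⟩
    have := mk_rel (Rel.braid_ne (Q := Q) i h ν hv)
    simpa [hT_of_lt h1, hT_of_lt h2] using this

theorem hT_sq (i : ℕ) (ν : Fin n → I) : ∃ D, hT Q i (swapSeq i ν) * hT Q i ν = phiNu Q ν D := by
  by_cases h : i + 1 < n
  · obtain ⟨D, hD⟩ := mk_pev (Q (ν ⟨i, by omega⟩) (ν ⟨i + 1, h⟩)) (i := i) (j := i + 1) (by omega) h ν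
      (Q := Q)
    refine ⟨D, ?_⟩
    rw [← hD, ← mk_rel (Rel.tau_sq (Q := Q) i h ν), map_mul, hT_of_lt h, hT_of_lt h]
  · exact ⟨0, by simp [hT_of_not_lt h]⟩

theorem hW_sub_mem_of_core {core core' : List ℕ} {v : List ℕ} (u : List ℕ) {ν : Fin n → I}
    {D : MvPolynomial (Fin n) k} (hs : seqActWord core (seqActWord v ν) =
      seqActWord core' (seqActWord v ν))
    (h : hW Q core (seqActWord v ν) = hW Q core' (seqActWord v ν) + phiNu Q (seqActWord v ν) D)
    (hl : 0 < core.length) :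
    hW Q (u ++ (core ++ v)) ν - hW Q (u ++ (core' ++ v)) ν ∈
      wordFil Q ν (u ++ (core ++ v)).length := by
  simp only [hW_append, seqActWord_append, h, hs]
  rw [← mul_sub, ← sub_mul, add_sub_cancel_left]
  exact wordFil_mono (by simp; omega) (hW_mul_phiNu_mul_hW_mem_wordFil ν _ _ u v D)

theorem Move.hW_sub_mem {l l' : List ℕ} (h : Move n l l') (ν : Fin n → I) :
    hW Q l ν - hW Q l' ν ∈ wordFil Q ν l.length := by
  cases h with
  | far u v i j hi hj hij =>
    refine hW_sub_mem_of_core (D := 0) u ?_ ?_ (by simp)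
    · simp [seqActWord, swapSeq_far hi hj hij]
    · simp [seqActWord, ← mul_assoc, hT_far hi hj hij]
  | far' u v i j hi hj hij =>
    refine hW_sub_mem_of_core (D := 0) u ?_ ?_ (by simp)
    · simp [seqActWord, swapSeq_far hi hj hij]
    · simp [seqActWord, ← mul_assoc, hT_far hi hj hij]
  | braid u v i h =>
    obtain ⟨D, hD⟩ := hT_braid (Q := Q) h (seqActWord v ν)
    refine hW_sub_mem_of_core (D := D) u ?_ ?_ (by simp)
    · simp [seqActWord, swapSeq_braid h]
    · simp only [hW_cons, hW_nil, seqActWord, ← mul_assoc, hD, add_mul, phiNu_mul_hE]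

theorem hW_double_mem (u v : List ℕ) (i : ℕ) (ν : Fin n → I) :
    hW Q (u ++ i :: i :: v) ν ∈ wordFil Q ν (u ++ i :: i :: v).length := by
  obtain ⟨D, hD⟩ := hT_sq (Q := Q) i (seqActWord v ν)
  rw [hW_append, hW_cons, hW_cons, ← mul_assoc (hT Q i _), show seqActWord (i :: v) ν =
    swapSeq i (seqActWord v ν) from rfl, hD]
  exact wordFil_mono (by simp) (hW_mul_phiNu_mul_hW_mem_wordFil ν _ _ u v D)

theorem hW_sub_mem_of_moves {l l' : List ℕ} (h : Relation.ReflTransGen (Move n) l l')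
    (ν : Fin n → I) :
    l.length = l'.length ∧ hW Q l ν - hW Q l' ν ∈ wordFil Q ν l.length := by
  induction h with
  | refl => exact ⟨rfl, by simp⟩
  | tail _ hm ih =>
    refine ⟨ih.1.trans hm.length_eq, ?_⟩
    rw [← sub_add_sub_cancel]
    refine add_mem ih.2 ?_
    rw [ih.1]
    exact hm.hW_sub_mem ν

/-- Normal forms of words on `m` strands: a descending chain of coset representatives. -/
def nfSet : ℕ → Finset (List ℕ)
  | 0 => {[]}
  | m + 1 => Finset.image₂ (fun j l => List.range' j (m - j) ++ l) (Finset.range (m + 1)) (nfSet m)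

theorem card_nfSet_le (m : ℕ) : (nfSet m).card ≤ m.factorial := by
  induction m with
  | zero => simp [nfSet]
  | succ m ih =>
    rw [nfSet, Nat.factorial_succ]
    refine (Finset.card_image₂_le _ _ _).trans ?_
    rw [Finset.card_range]
    exact Nat.mul_le_mul_left _ ih

theorem nil_mem_nfSet (m : ℕ) : [] ∈ nfSet m := by
  induction m with
  | zero => simp [nfSet]
  | succ m ih =>
    exact Finset.mem_image₂.mpr ⟨m, by simp, [], ih, by simp⟩

/-- The word can be brought by braid moves to a normal form or to a word with a repeated letter. -/
def Straightens (n m : ℕ) (w : List ℕ) : Prop :=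
  (∃ l ∈ nfSet m, Relation.ReflTransGen (Move n) w l) ∨
    ∃ u i v, Relation.ReflTransGen (Move n) w (u ++ i :: i :: v)

theorem Straightens.of_moves {m : ℕ} {w w' : List ℕ} (h : Relation.ReflTransGen (Move n) w w')
    (h' : Straightens n m w') : Straightens n m w := by
  rcases h' with ⟨l, hl, h1⟩ | ⟨u, i, v, h1⟩
  · exact Or.inl ⟨l, hl, h.trans h1⟩
  · exact Or.inr ⟨u, i, v, h.trans h1⟩

theorem moves_append_left (u : List ℕ) {w w' : List ℕ} (h : Relation.ReflTransGen (Move n) w w') :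
    Relation.ReflTransGen (Move n) (u ++ w) (u ++ w') :=
  h.lift (u ++ ·) fun _ _ hm => hm.append_left u

theorem Straightens.range'_append {m j : ℕ} (hj : j ≤ m) {w : List ℕ} (h : Straightens n m w) :
    Straightens n (m + 1) (List.range' j (m - j) ++ w) := by
  rcases h with ⟨l, hl, h1⟩ | ⟨u, i, v, h1⟩
  · exact Or.inl ⟨_, Finset.mem_image₂.mpr ⟨j, by simpa [Nat.lt_succ_iff] using hj, l, hl, rfl⟩,
      moves_append_left _ h1⟩
  · exact Or.inr ⟨List.range' j (m - j) ++ u, i, v, by simpa using moves_append_left _ h1⟩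

theorem moves_far_range' {i : ℕ} (v : List ℕ) (c j : ℕ) (hj : i + 2 ≤ j) (hc : j + c + 1 ≤ n) :
    Relation.ReflTransGen (Move n) (i :: (List.range' j c ++ v)) (List.range' j c ++ i :: v) := by
  induction c generalizing j with
  | zero => exact .refl
  | succ c ih =>
    rw [List.range'_succ]
    refine .trans (.single (Move.far [] _ i j (by omega) (by omega) hj)) ?_
    exact moves_append_left [j] (ih (j + 1) (by omega) (by omega))

theorem moves_range'_far {i : ℕ} (v : List ℕ) (c j : ℕ) (hi : i + 1 < n) (hj : j + c + 1 ≤ i) :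
    Relation.ReflTransGen (Move n) (i :: (List.range' j c ++ v)) (List.range' j c ++ i :: v) := by
  induction c generalizing j with
  | zero => exact .refl
  | succ c ih =>
    rw [List.range'_succ]
    refine .trans (.single (Move.far' [] _ j i (by omega) (by omega) (by omega))) ?_
    exact moves_append_left [j] (ih (j + 1) (by omega))

theorem straightens_cons {m : ℕ} (hm : m ≤ n) {i : ℕ} (hi : i + 1 < m) {l : List ℕ}
    (hl : l ∈ nfSet m) : Straightens n m (i :: l) := by
  induction m generalizing i l with
  | zero => omega
  | succ m ih =>
    obtain ⟨j, hj, r, hr, rfl⟩ := Finset.mem_image₂.mp hl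
    rw [Finset.mem_range] at hj
    rcases lt_trichotomy i j with hij | rfl | hij
    · by_cases hij' : i + 1 = j
      · subst hij'
        refine Or.inl ⟨_, Finset.mem_image₂.mpr ⟨i, by simp; omega, r, hr, rfl⟩, ?_⟩
        rw [show m - i = (m - (i + 1)) + 1 by omega, List.range'_succ]
        exact .refl
      · exact .of_moves (moves_far_range' r _ j (by omega) (by omega))
          (.range'_append (by omega) (ih (by omega) (by omega) hr))
    · refine Or.inr ⟨[], i, List.range' (i + 1) (m - (i + 1)) ++ r, ?_⟩
      rw [show m - i = (m - (i + 1)) + 1 by omega, List.range'_succ]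
      exact .refl
    · obtain ⟨i, rfl⟩ : ∃ i', i = i' + 1 := ⟨i - 1, by omega⟩
      refine .of_moves ?_ (.range'_append (m := m) (j := j) (w := i :: r) (by omega)
        (ih (by omega) (by omega) hr))
      have e : List.range' j (m - j) =
          List.range' j (i - j) ++ i :: (i + 1) :: List.range' (i + 2) (m - (i + 2)) := by
        rw [show m - j = (i - j) + ((m - (i + 2)) + 1 + 1) by omega, ← List.range'_append_1,
          show j + (i - j) = i by omega, List.range'_succ, List.range'_succ]
      rw [e]
      simp only [List.append_assoc, List.cons_append]
      refine (moves_range'_far _ _ j (by omega) (by omega)).trans (moves_append_left _ ?_)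
      refine .trans (.single (Move.braid [] _ i (by omega))) ?_
      exact moves_append_left [i, i + 1] (moves_far_range' r _ (i + 2) (by omega) (by omega))

theorem hW_normal_form (l : List ℕ) (ν : Fin n → I) :
    (∃ l' ∈ nfSet n, l.length = l'.length ∧ hW Q l ν - hW Q l' ν ∈ wordFil Q ν l.length) ∨
      hW Q l ν ∈ wordFil Q ν l.length := by
  induction l with
  | nil => exact Or.inl ⟨[], nil_mem_nfSet n, rfl, by simp⟩
  | cons i l ih =>
    by_cases hi : i + 1 < n
    swap
    · right
      rw [hW_cons, hT_of_not_lt hi, zero_mul]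
      exact zero_mem _
    rcases ih with ⟨l', hl', hlen, h⟩ | h
    swap
    · right
      rw [hW_cons]
      exact hT_mul_mem_wordFil _ _ h
    have h1 := hT_mul_mem_wordFil i (seqActWord l ν) h
    rw [mul_sub, ← hW_cons] at h1
    by_cases hs : seqActWord l ν = seqActWord l' ν
    swap
    · right
      rwa [hT_mul_hW_ne hs, sub_zero] at h1
    rw [hs, ← hW_cons] at h1
    have hlen' : (i :: l).length = (i :: l').length := by simp [hlen]
    rcases straightens_cons le_rfl hi hl' with ⟨l'', hl'', hm⟩ | ⟨u, j, v, hm⟩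
    · obtain ⟨h2, h3⟩ := hW_sub_mem_of_moves (Q := Q) hm ν
      refine Or.inl ⟨l'', hl'', hlen'.trans h2, ?_⟩
      rw [← hlen'] at h3
      rw [← sub_add_sub_cancel]
      exact add_mem h1 h3
    · obtain ⟨h2, h3⟩ := hW_sub_mem_of_moves (Q := Q) hm ν
      right
      have h4 := hW_double_mem (Q := Q) u v j ν
      rw [← h2, ← hlen'] at h4
      rw [← hlen'] at h3
      have := add_mem (add_mem h1 h3) h4
      simpa using this

variable (Q) in
/-- The span of the normal-form elements `τ_l φ(P) 1_ν`. -/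
noncomputable def nfSpan (ν : Fin n → I) : Submodule k (HQ k I n Q) :=
  Submodule.span k {y | ∃ l ∈ nfSet n, ∃ P, y = hW Q l ν * phiNu Q ν P}

theorem wordFil_le_nfSpan (ν : Fin n → I) (d : ℕ) : wordFil Q ν d ≤ nfSpan Q ν := by
  induction d with
  | zero =>
    rw [wordFil, Submodule.span_le]
    rintro _ ⟨l, P, hl, -⟩
    omega
  | succ d ih =>
    rw [wordFil, Submodule.span_le]
    rintro _ ⟨l, P, hl, rfl⟩
    rcases (Nat.lt_succ_iff.mp hl).lt_or_eq with h | rfl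
    · exact ih (mem_wordFil h P)
    · rcases hW_normal_form (Q := Q) l ν with ⟨l', hl', -, h⟩ | h
      · have h1 := ih (mul_phiNu_mem_wordFil P h)
        rw [sub_mul] at h1
        have := add_mem h1 (Submodule.subset_span ⟨l', hl', P, rfl⟩ :
          hW Q l' ν * phiNu Q ν P ∈ nfSpan Q ν)
        simpa using this
      · exact ih (mul_phiNu_mem_wordFil P h)

theorem mk_mul_mem_nfSpan (ν : Fin n → I) (h : FA k I n) :
    ∀ y ∈ nfSpan Q ν, mk Q h * y ∈ nfSpan Q ν := by
  induction h using FreeAlgebra.induction with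
  | grade0 r =>
    intro y hy
    rw [AlgHom.commutes, ← Algebra.smul_def]
    exact Submodule.smul_mem _ _ hy
  | mul a b ha hb =>
    intro y hy
    rw [map_mul, mul_assoc]
    exact ha _ (hb _ hy)
  | add a b ha hb =>
    intro y hy
    rw [map_add, add_mul]
    exact add_mem (ha _ hy) (hb _ hy)
  | grade1 g =>
    intro y hy
    refine mul_mem_of_forall_generator rfl ?_ hy
    rintro _ ⟨l, -, P, rfl⟩
    have hφ : ∀ (μ : Fin n → I) R, phiNu Q μ R * (hW Q l ν * phiNu Q ν P) ∈ nfSpan Q ν := by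
      intro μ R
      rw [← mul_assoc]
      exact wordFil_le_nfSpan ν _ (mul_phiNu_mem_wordFil P (phiNu_mul_hW_mem_wordFil ν μ l R))
    cases g with
    | unit μ =>
      have := hφ μ 1
      rw [phiNu_one] at this
      exact this
    | x a μ =>
      have := hφ μ (X a)
      rw [phiNu_X] at this
      exact this
    | tau i hi μ =>
      have := wordFil_le_nfSpan ν _
        (hT_mul_mem_wordFil i μ (mem_wordFil (Q := Q) (ν := ν) l.length.lt_succ_self P))
      rwa [hT_of_lt hi] at this

theorem mul_hE_mem_nfSpan (h : HQ k I n Q) (ν : Fin n → I) : h * hE Q ν ∈ nfSpan Q ν := by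
  obtain ⟨h, rfl⟩ := RingQuot.mkAlgHom_surjective k (Rel Q) h
  refine mk_mul_mem_nfSpan ν h _ (Submodule.subset_span ⟨[], nil_mem_nfSet n, 1, ?_⟩)
  simp [hE_mul_self]

theorem exists_mul_hE_eq_sum (h : HQ k I n Q) (ν : Fin n → I) :
    ∃ P : List ℕ → MvPolynomial (Fin n) k,
      h * hE Q ν = ∑ l ∈ nfSet n, hW Q l ν * phiNu Q ν (P l) := by
  have key : ∀ y ∈ nfSpan Q ν, ∃ P : List ℕ → MvPolynomial (Fin n) k,
      y = ∑ l ∈ nfSet n, hW Q l ν * phiNu Q ν (P l) := by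
    intro y hy
    induction hy using Submodule.span_induction with
    | mem y hy =>
      obtain ⟨l, hl, P, rfl⟩ := hy
      refine ⟨fun l' => if l' = l then P else 0, ?_⟩
      rw [Finset.sum_eq_single_of_mem l hl]
      · simp
      · intro l' _ h
        simp [h]
    | zero => exact ⟨0, by simp⟩
    | add y y' _ _ h h' =>
      obtain ⟨P, rfl⟩ := h
      obtain ⟨P', rfl⟩ := h'
      exact ⟨P + P', by simp [phiNu_add, mul_add, Finset.sum_add_distrib]⟩
    | smul c y _ h =>
      obtain ⟨P, rfl⟩ := h
      exact ⟨c • P, by simp [phiNu_smul, Finset.smul_sum]⟩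
  exact key _ (mul_hE_mem_nfSpan h ν)

end Rouq

namespace Rouq

open MvPolynomial

variable {k : Type} [CommRing k] {I : Type} {n : ℕ}

theorem isRegular_X_sub_X {a b : Fin n} (h : a ≠ b) :
    IsRegular (X a - X b : MvPolynomial (Fin n) k) := by
  let f : MvPolynomial (Fin n) k →ₐ[k] MvPolynomial (Fin n) k :=
    aeval (fun c => if c = a then X a + X b else X c)
  let g : MvPolynomial (Fin n) k →ₐ[k] MvPolynomial (Fin n) k :=
    aeval (fun c => if c = a then X a - X b else X c)
  have hgf : ∀ P, g (f P) = P := fun P => by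
    have : g.comp f = AlgHom.id k _ := by
      ext c
      by_cases hc : c = a
      · subst hc; simp [f, g, h.symm]
      · simp [f, g, hc]
    exact DFunLike.congr_fun this P
  have hf : f (X a - X b) = X a := by simp [f, h.symm]
  have hl : IsLeftRegular (X a - X b : MvPolynomial (Fin n) k) := by
    intro P R hPR
    have := congrArg f hPR
    simp only [map_mul, hf] at this
    rw [← hgf P, ← hgf R, isRegular_X.left this]
  exact ⟨hl, hl.right_of_commute (Commute.all _)⟩

/-- The total ring of fractions of the polynomial ring. -/
def FR (k : Type) [CommRing k] (n : ℕ) : Type := FractionRing (MvPolynomial (Fin n) k)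

noncomputable instance : CommRing (FR k n) :=
  inferInstanceAs (CommRing (FractionRing (MvPolynomial (Fin n) k)))

noncomputable instance : Algebra (MvPolynomial (Fin n) k) (FR k n) :=
  inferInstanceAs (Algebra _ (FractionRing (MvPolynomial (Fin n) k)))

instance : IsFractionRing (MvPolynomial (Fin n) k) (FR k n) :=
  inferInstanceAs (IsFractionRing _ (FractionRing (MvPolynomial (Fin n) k)))

noncomputable instance : Algebra k (FR k n) :=
  inferInstanceAs (Algebra k (FractionRing (MvPolynomial (Fin n) k)))

instance : IsScalarTower k (MvPolynomial (Fin n) k) (FR k n) :=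
  inferInstanceAs (IsScalarTower k _ (FractionRing (MvPolynomial (Fin n) k)))

/-- The variables in the fraction ring. -/
noncomputable def yv (k : Type) [CommRing k] (a : Fin n) : FR k n :=
  algebraMap (MvPolynomial (Fin n) k) (FR k n) (X a)

/-- The inverse of `y_a - y_b` in the fraction ring. -/
noncomputable def dinv (k : Type) [CommRing k] (a b : Fin n) : FR k n :=
  Ring.inverse (yv k a - yv k b)

theorem mul_dinv {a b : Fin n} (h : a ≠ b) : (yv k a - yv k b) * dinv k a b = 1 := by
  apply Ring.mul_inverse_cancel
  rw [yv, yv, ← map_sub]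
  exact IsLocalization.map_units (FR k n) (M := nonZeroDivisors (MvPolynomial (Fin n) k))
    ⟨X a - X b, (isRegular_X_sub_X h).mem_nonZeroDivisors⟩

theorem dinv_swap {a b : Fin n} (h : a ≠ b) : dinv k b a = -dinv k a b := by
  linear_combination (-dinv k b a) * mul_dinv (k := k) h - dinv k a b * mul_dinv (k := k) h.symm

/-- Evaluation of a two-variable polynomial in the fraction ring. -/
noncomputable def ev (R : MvPolynomial (Fin 2) k) (a b : Fin n) : FR k n :=
  aeval ![yv k a, yv k b] R

theorem ev_eq (R : MvPolynomial (Fin 2) k) (a b : Fin n) :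
    ev R a b = ∑ m ∈ R.support, R.coeff m • (yv k a ^ m 0 * yv k b ^ m 1) := by
  rw [ev, aeval_def, eval₂_eq']
  simp [Algebra.smul_def]

theorem ev_rename_swap (R : MvPolynomial (Fin 2) k) (a b : Fin n) :
    ev (rename (Equiv.swap (0 : Fin 2) 1) R) a b = ev R b a := by
  rw [ev, ev, aeval_rename]
  congr 2
  funext i
  fin_cases i <;> simp

/-- The divided difference of `R` in the first variable, evaluated in the fraction ring. -/
noncomputable def evDiff (R : MvPolynomial (Fin 2) k) (a b c : Fin n) : FR k n :=
  ∑ m ∈ R.support, R.coeff m •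
    ((∑ t ∈ Finset.range (m 0), yv k c ^ t * yv k a ^ (m 0 - 1 - t)) * yv k b ^ m 1)

theorem evDiff_mul (R : MvPolynomial (Fin 2) k) (a b c : Fin n) :
    evDiff R a b c * (yv k c - yv k a) = ev R c b - ev R a b := by
  rw [evDiff, ev_eq, ev_eq, Finset.sum_mul, ← Finset.sum_sub_distrib]
  refine Finset.sum_congr rfl fun m _ => ?_
  rw [← smul_sub, smul_mul_assoc, ← sub_mul, ← Commute.geom_sum₂_mul (Commute.all _ _)]
  congr 1
  ring

/-- The free module with basis the arrangements of labelled strands. -/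
abbrev Strands (k : Type) [CommRing k] (n : ℕ) := Equiv.Perm (Fin n) →₀ FR k n

/-- The basis vector attached to an arrangement of strands. -/
noncomputable abbrev bas (k : Type) [CommRing k] (w : Equiv.Perm (Fin n)) : Strands k n :=
  Finsupp.single w 1

/-- The sequence of colours of an arrangement, for strands coloured by `ν`. -/
def col (ν : Fin n → I) (w : Equiv.Perm (Fin n)) : Fin n → I := fun a => ν (w⁻¹ a)

theorem adj_inv (i : ℕ) : (adj n i)⁻¹ = adj n i := by
  ext a
  rw [Equiv.Perm.inv_eq_iff_eq.mpr (adj_adj i a).symm]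

theorem col_adj_mul (ν : Fin n → I) (i : ℕ) (w : Equiv.Perm (Fin n)) :
    col ν (adj n i * w) = swapSeq i (col ν w) := by
  funext a
  simp [col, swapSeq_eq, adj_inv]

theorem strands_end_ext {f g : Module.End (FR k n) (Strands k n)}
    (h : ∀ w, f (bas k w) = g (bas k w)) : f = g := by
  ext w : 2
  simpa using h w

open Classical in
/-- Coefficient of the uncrossed arrangement when strands `a`, `b` meet. -/
noncomputable def stay (k : Type) [CommRing k] (ν : Fin n → I) (a b : Fin n) : FR k n :=
  if ν a = ν b then -dinv k a b else 0

open Classical in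
/-- Coefficient of the crossed arrangement when strands `a`, `b` meet. -/
noncomputable def move (Q : I → I → MvPolynomial (Fin 2) k) (ν : Fin n → I) (a b : Fin n) :
    FR k n :=
  if ν a = ν b then dinv k a b else if a < b then 1 else ev (Q (ν a) (ν b)) a b

open Classical in
/-- The projection to arrangements with colour sequence `μ`. -/
noncomputable def opE (k : Type) [CommRing k] (ν μ : Fin n → I) :
    Module.End (FR k n) (Strands k n) :=
  Finsupp.linearCombination (FR k n) fun w => if col ν w = μ then bas k w else 0

/-- Multiplication by the variable of the strand at position `a`. -/
noncomputable def opX (k : Type) [CommRing k] (a : Fin n) : Module.End (FR k n) (Strands k n) :=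
  Finsupp.linearCombination (FR k n) fun w => yv k (w⁻¹ a) • bas k w

/-- The crossing operator at positions `i`, `i + 1`. -/
noncomputable def opT (Q : I → I → MvPolynomial (Fin 2) k) (ν : Fin n → I) (i : ℕ)
    (h : i + 1 < n) : Module.End (FR k n) (Strands k n) :=
  Finsupp.linearCombination (FR k n) fun w =>
    move Q ν (w⁻¹ ⟨i, by omega⟩) (w⁻¹ ⟨i + 1, h⟩) • bas k (adj n i * w) +
      stay k ν (w⁻¹ ⟨i, by omega⟩) (w⁻¹ ⟨i + 1, h⟩) • bas k w

variable (Q : I → I → MvPolynomial (Fin 2) k) (ν : Fin n → I)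

theorem opE_bas (μ : Fin n → I) {w : Equiv.Perm (Fin n)} (h : col ν w = μ) :
    opE k ν μ (bas k w) = bas k w := by
  simp [opE, h]

theorem opE_bas_ne (μ : Fin n → I) {w : Equiv.Perm (Fin n)} (h : col ν w ≠ μ) :
    opE k ν μ (bas k w) = 0 := by
  simp [opE, h]

theorem opX_bas (a : Fin n) (w : Equiv.Perm (Fin n)) :
    opX k a (bas k w) = yv k (w⁻¹ a) • bas k w := by
  simp [opX]

theorem opT_bas (i : ℕ) (h : i + 1 < n) (w : Equiv.Perm (Fin n)) :
    opT Q ν i h (bas k w) =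
      move Q ν (w⁻¹ ⟨i, by omega⟩) (w⁻¹ ⟨i + 1, h⟩) • bas k (adj n i * w) +
        stay k ν (w⁻¹ ⟨i, by omega⟩) (w⁻¹ ⟨i + 1, h⟩) • bas k w := by
  rw [opT, Finsupp.linearCombination_single, one_smul]

/-- The operators attached to the generators. -/
noncomputable def genOp : Gen I n → Module.End (FR k n) (Strands k n)
  | .unit μ => opE k ν μ
  | .x a μ => opX k a * opE k ν μ
  | .tau i h μ => opT Q ν i h * opE k ν μ

/-- The action of the free algebra on arrangements of strands. -/
noncomputable def freeRep : FA k I n →ₐ[k] Module.End (FR k n) (Strands k n) :=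
  FreeAlgebra.lift k (genOp Q ν)

@[simp] theorem freeRep_E (μ : Fin n → I) : freeRep Q ν (E k μ) = opE k ν μ := by
  simp [freeRep, E, genOp]

@[simp] theorem freeRep_Xg (a : Fin n) (μ : Fin n → I) :
    freeRep Q ν (Xg k a μ) = opX k a * opE k ν μ := by
  simp [freeRep, Xg, genOp]

@[simp] theorem freeRep_Tg (i : ℕ) (h : i + 1 < n) (μ : Fin n → I) :
    freeRep Q ν (Tg k i h μ) = opT Q ν i h * opE k ν μ := by
  simp [freeRep, Tg, genOp]

theorem freeRep_Xn {i : ℕ} (h : i < n) (μ : Fin n → I) :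
    freeRep Q ν (Xn k i μ) = opX k ⟨i, h⟩ * opE k ν μ := by
  rw [Xn, dif_pos h, freeRep_Xg]

theorem opE_opT_bas (i : ℕ) (h : i + 1 < n) (w : Equiv.Perm (Fin n)) :
    opE k ν (swapSeq i (col ν w)) (opT Q ν i h (bas k w)) = opT Q ν i h (bas k w) := by
  rw [opT_bas, map_add, map_smul, map_smul, opE_bas _ _ (col_adj_mul ν i w)]
  congr 1
  by_cases hc : ν (w⁻¹ ⟨i, by omega⟩) = ν (w⁻¹ ⟨i + 1, h⟩)
  · rw [opE_bas]
    exact (swapSeq_of_eq h hc).symm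
  · have : stay k ν (w⁻¹ ⟨i, by omega⟩) (w⁻¹ ⟨i + 1, h⟩) = 0 := if_neg hc
    rw [this, zero_smul, zero_smul]

theorem opE_mul_opT_mul_opE (i : ℕ) (h : i + 1 < n) (μ : Fin n → I) :
    opE k ν (swapSeq i μ) * opT Q ν i h * opE k ν μ = opT Q ν i h * opE k ν μ := by
  refine strands_end_ext fun w => ?_
  by_cases hw : col ν w = μ
  · subst hw
    simp only [Module.End.mul_apply, opE_bas _ _ rfl, opE_opT_bas]
  · simp only [Module.End.mul_apply, opE_bas_ne _ _ hw, map_zero]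

theorem opE_mul_self (μ : Fin n → I) : opE k ν μ * opE k ν μ = opE k ν μ := by
  refine strands_end_ext fun w => ?_
  by_cases hw : col ν w = μ
  · simp only [Module.End.mul_apply, opE_bas _ _ hw]
  · simp only [Module.End.mul_apply, opE_bas_ne _ _ hw, map_zero]

theorem opE_mul_opX (a : Fin n) (μ : Fin n → I) :
    opE k ν μ * opX k a = opX k a * opE k ν μ := by
  refine strands_end_ext fun w => ?_
  by_cases hw : col ν w = μ
  · simp only [Module.End.mul_apply, opE_bas _ _ hw, opX_bas, map_smul]
  · simp only [Module.End.mul_apply, opE_bas_ne _ _ hw, opX_bas, map_smul, map_zero, smul_zero]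

theorem opX_opE_pow_bas (a : Fin n) (w : Equiv.Perm (Fin n)) (t : ℕ) :
    ((opX k a * opE k ν (col ν w)) ^ t) (bas k w) = yv k (w⁻¹ a) ^ t • bas k w := by
  induction t with
  | zero => simp
  | succ t ih =>
    rw [pow_succ, Module.End.mul_apply, Module.End.mul_apply, opE_bas _ _ rfl, opX_bas, map_smul,
      ih, smul_smul, pow_succ, mul_comm]

theorem freeRep_pev (R : MvPolynomial (Fin 2) k) {i j : ℕ} (hi : i < n) (hj : j < n)
    (w : Equiv.Perm (Fin n)) :
    freeRep Q ν (pev R (Xn k i (col ν w)) (Xn k j (col ν w)) (E k (col ν w))) (bas k w) =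
      ev R (w⁻¹ ⟨i, hi⟩) (w⁻¹ ⟨j, hj⟩) • bas k w := by
  rw [ev_eq, pev, map_sum, LinearMap.sum_apply, Finset.sum_smul]
  refine Finset.sum_congr rfl fun m _ => ?_
  rw [map_smul, map_mul, map_mul, map_pow, map_pow, freeRep_E, freeRep_Xn Q ν hi,
    freeRep_Xn Q ν hj, LinearMap.smul_apply, Module.End.mul_apply, Module.End.mul_apply,
    opE_bas _ _ rfl, opX_opE_pow_bas, map_smul, opX_opE_pow_bas, smul_smul, smul_assoc, mul_comm]

theorem freeRep_pevDiff (R : MvPolynomial (Fin 2) k) {i j l : ℕ} (hi : i < n) (hj : j < n)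
    (hl : l < n) (w : Equiv.Perm (Fin n)) :
    freeRep Q ν (pevDiff R (Xn k i (col ν w)) (Xn k j (col ν w)) (Xn k l (col ν w))
      (E k (col ν w))) (bas k w) =
      evDiff R (w⁻¹ ⟨i, hi⟩) (w⁻¹ ⟨j, hj⟩) (w⁻¹ ⟨l, hl⟩) • bas k w := by
  rw [evDiff, pevDiff, map_sum, LinearMap.sum_apply, Finset.sum_smul]
  refine Finset.sum_congr rfl fun m _ => ?_
  rw [map_smul, map_mul, map_mul, map_pow, map_sum, freeRep_E, freeRep_Xn Q ν hj,
    LinearMap.smul_apply, Module.End.mul_apply, Module.End.mul_apply,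
    opE_bas _ _ rfl, opX_opE_pow_bas, map_smul, LinearMap.sum_apply, smul_assoc, mul_comm,
    ← smul_smul, Finset.sum_smul]
  congr 2
  refine Finset.sum_congr rfl fun t _ => ?_
  rw [map_mul, map_pow, map_pow, freeRep_Xn Q ν hi, freeRep_Xn Q ν hl, Module.End.mul_apply,
    opX_opE_pow_bas, map_smul, opX_opE_pow_bas, smul_smul, mul_comm]

variable {Q ν}

theorem stay_swap {a b : Fin n} (h : a ≠ b) : stay k ν b a = -stay k ν a b := by
  by_cases hc : ν a = ν b
  · simp [stay, hc, dinv_swap h]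
  · simp [stay, hc, Ne.symm hc]

theorem stay_mul_sub {a b : Fin n} (h : a ≠ b) (hc : ν a = ν b) :
    stay k ν a b * (yv k a - yv k b) = -1 := by
  rw [stay, if_pos hc]
  linear_combination -mul_dinv (k := k) h

theorem stay_of_ne {a b : Fin n} (hc : ν a ≠ ν b) : stay k ν a b = 0 := if_neg hc

theorem stay_relation {a b c : Fin n} (hab : a ≠ b) (hac : a ≠ c) (hbc : b ≠ c) :
    stay k ν a b * stay k ν b c = stay k ν a b * stay k ν a c + stay k ν b c * stay k ν a c := by
  by_cases h1 : ν a = ν b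
  · by_cases h2 : ν b = ν c
    · have e1 := stay_mul_sub (k := k) hab h1
      have e2 := stay_mul_sub (k := k) hbc h2
      have e3 := stay_mul_sub (k := k) hac (h1.trans h2)
      linear_combination (-stay k ν a c * stay k ν b c) * e1 - stay k ν a c * stay k ν a b * e2 +
        stay k ν a b * stay k ν b c * e3
    · rw [stay_of_ne h2, stay_of_ne (a := a) (b := c) (fun h => h2 (h1.symm.trans h))]
      ring
  · rw [stay_of_ne h1]
    by_cases h2 : ν b = ν c
    · rw [stay_of_ne (a := a) (b := c) (fun h => h1 (h.trans h2.symm))]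
      ring
    · rw [stay_of_ne h2]
      ring

theorem ev_hermitian (hherm : Hermitian Q) (i j : I) (a b : Fin n) :
    ev (Q i j) a b = ev (Q j i) b a := by
  rw [hherm i j, ev_rename_swap]

theorem move_mul_move_of_eq {a b : Fin n} (h : a ≠ b) (hc : ν a = ν b) :
    move Q ν a b * move Q ν b a = -stay k ν a b ^ 2 := by
  simp only [move, stay, hc, if_true, dinv_swap h]
  ring

theorem move_mul_move_of_ne (hherm : Hermitian Q) {a b : Fin n} (hc : ν a ≠ ν b) :
    move Q ν a b * move Q ν b a = ev (Q (ν a) (ν b)) a b := by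
  have h : a ≠ b := fun e => hc (by rw [e])
  rcases lt_or_gt_of_ne h with hlt | hlt
  · simp [move, hc, hc.symm, hlt, hlt.not_gt, ev_hermitian hherm (ν b) (ν a)]
  · simp [move, hc, hc.symm, hlt, hlt.not_gt]

theorem adj_left {i : ℕ} (h : i + 1 < n) : adj n i ⟨i, by omega⟩ = ⟨i + 1, h⟩ := by
  rw [adj_of_lt h, Equiv.swap_apply_left]

theorem adj_right {i : ℕ} (h : i + 1 < n) : adj n i ⟨i + 1, h⟩ = ⟨i, by omega⟩ := by
  rw [adj_of_lt h, Equiv.swap_apply_right]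

theorem adj_mul_inv_apply (i : ℕ) (w : Equiv.Perm (Fin n)) (a : Fin n) :
    (adj n i * w)⁻¹ a = w⁻¹ (adj n i a) := by
  rw [mul_inv_rev, adj_inv, Equiv.Perm.mul_apply]

theorem adj_mul_adj_mul (i : ℕ) (w : Equiv.Perm (Fin n)) : adj n i * (adj n i * w) = w := by
  rw [← mul_assoc]
  ext a
  simp [adj_adj]

theorem adj_comm {i j : ℕ} (hi : i + 1 < n) (hj : j + 1 < n) (hij : i + 2 ≤ j)
    (w : Equiv.Perm (Fin n)) : adj n i * (adj n j * w) = adj n j * (adj n i * w) := by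
  ext a
  simp only [Equiv.Perm.mul_apply, adj_apply_val hi, adj_apply_val hj]
  split_ifs <;> omega

theorem adj_braid {i : ℕ} (h : i + 2 < n) (w : Equiv.Perm (Fin n)) :
    adj n (i + 1) * (adj n i * (adj n (i + 1) * w)) = adj n i * (adj n (i + 1) * (adj n i * w)) := by
  ext a
  simp only [Equiv.Perm.mul_apply, adj_apply_val (show i + 1 < n by omega),
    adj_apply_val (show i + 1 + 1 < n by omega)]
  split_ifs <;> omega

theorem opT_opT_bas (hQdiag : ∀ i, Q i i = 0) (hherm : Hermitian Q) (i : ℕ) (h : i + 1 < n)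
    (w : Equiv.Perm (Fin n)) :
    opT Q ν i h (opT Q ν i h (bas k w)) =
      ev (Q (col ν w ⟨i, by omega⟩) (col ν w ⟨i + 1, h⟩)) (w⁻¹ ⟨i, by omega⟩) (w⁻¹ ⟨i + 1, h⟩) •
        bas k w := by
  simp only [opT_bas, map_add, map_smul, adj_mul_inv_apply, adj_left h, adj_right h,
    adj_mul_adj_mul, col]
  have hab : w⁻¹ ⟨i, by omega⟩ ≠ w⁻¹ ⟨i + 1, h⟩ := by simp
  generalize w⁻¹ ⟨i, by omega⟩ = a at *
  generalize w⁻¹ ⟨i + 1, h⟩ = b at *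
  have e1 : stay k ν b a = -stay k ν a b := stay_swap hab
  have e2 : move Q ν a b * move Q ν b a + stay k ν a b ^ 2 = ev (Q (ν a) (ν b)) a b := by
    by_cases hc : ν a = ν b
    · rw [move_mul_move_of_eq hab hc, hc, hQdiag]
      simp [ev]
    · rw [move_mul_move_of_ne hherm hc, stay_of_ne hc]
      ring
  linear_combination (norm := module) (move Q ν a b * e1) • bas k (adj n i * w) + e2 • bas k w

theorem opT_far {i j : ℕ} (hi : i + 1 < n) (hj : j + 1 < n) (hij : i + 2 ≤ j)
    (w : Equiv.Perm (Fin n)) :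
    opT Q ν i hi (opT Q ν j hj (bas k w)) = opT Q ν j hj (opT Q ν i hi (bas k w)) := by
  have e1 : adj n j ⟨i, by omega⟩ = ⟨i, by omega⟩ := adj_apply_ne (by simp; omega) (by simp; omega)
  have e2 : adj n j ⟨i + 1, hi⟩ = ⟨i + 1, hi⟩ := adj_apply_ne (by simp; omega) (by simp; omega)
  have e3 : adj n i ⟨j, by omega⟩ = ⟨j, by omega⟩ := adj_apply_ne (by simp; omega) (by simp; omega)
  have e4 : adj n i ⟨j + 1, hj⟩ = ⟨j + 1, hj⟩ := adj_apply_ne (by simp; omega) (by simp; omega)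
  simp only [opT_bas, map_add, map_smul, adj_mul_inv_apply, e1, e2, e3, e4, adj_comm hi hj hij]
  module

theorem opT_braid {i : ℕ} (h : i + 2 < n) (w : Equiv.Perm (Fin n)) {γ : FR k n}
    (hγ : ∀ a b c : Fin n, a = w⁻¹ ⟨i, by omega⟩ → b = w⁻¹ ⟨i + 1, by omega⟩ → c = w⁻¹ ⟨i + 2, h⟩ →
      a ≠ b → a ≠ c → b ≠ c →
      move Q ν b c * move Q ν c b * stay k ν a c + stay k ν b c ^ 2 * stay k ν a b =
        move Q ν a b * move Q ν b a * stay k ν a c + stay k ν a b ^ 2 * stay k ν b c + γ) :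
    opT Q ν (i + 1) h (opT Q ν i (by omega) (opT Q ν (i + 1) h (bas k w))) =
      opT Q ν i (by omega) (opT Q ν (i + 1) h (opT Q ν i (by omega) (bas k w))) + γ • bas k w := by
  have h1 : i + 1 < n := by omega
  have e1 : adj n (i + 1) ⟨i, by omega⟩ = ⟨i, by omega⟩ :=
    adj_apply_ne (by simp) (by simp; omega)
  have e2 : adj n i ⟨i + 1 + 1, h⟩ = ⟨i + 1 + 1, h⟩ := adj_apply_ne (by simp; omega) (by simp)
  simp only [opT_bas, map_add, map_smul, adj_mul_inv_apply, e1, e2, adj_left h1, adj_right h1,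
    adj_left (show i + 1 + 1 < n from h), adj_right (show i + 1 + 1 < n from h), adj_mul_adj_mul,
    adj_braid h]
  have hab : w⁻¹ ⟨i, by omega⟩ ≠ w⁻¹ ⟨i + 1, h1⟩ := by simp
  have hac : w⁻¹ ⟨i, by omega⟩ ≠ w⁻¹ ⟨i + 1 + 1, h⟩ := by simp; omega
  have hbc : w⁻¹ ⟨i + 1, h1⟩ ≠ w⁻¹ ⟨i + 1 + 1, h⟩ := by simp
  have hγ' := hγ _ _ _ rfl rfl rfl hab hac hbc
  clear hγ
  change _ at hγ'
  generalize w⁻¹ ⟨i, by omega⟩ = a at *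
  generalize w⁻¹ ⟨i + 1, h1⟩ = b at *
  generalize w⁻¹ ⟨i + 1 + 1, h⟩ = c at *
  have k1 := stay_relation (k := k) (ν := ν) hab hac hbc
  have s1 : stay k ν b a = -stay k ν a b := stay_swap hab
  have s2 : stay k ν c b = -stay k ν b c := stay_swap hbc
  rw [s1, s2]
  linear_combination (norm := module) (-(move Q ν a b) * k1) • bas k (adj n i * w) +
    (move Q ν b c * k1) • bas k (adj n (i + 1) * w) + hγ' • bas k w

end Rouq

namespace Rouq

open MvPolynomial

variable {k : Type} [CommRing k] {I : Type} {n : ℕ}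

variable {Q : I → I → MvPolynomial (Fin 2) k} {ν : Fin n → I}

theorem opE_opT_of_opE {i : ℕ} (h : i + 1 < n) {μ : Fin n → I} {v : Strands k n}
    (hv : opE k ν μ v = v) : opE k ν (swapSeq i μ) (opT Q ν i h v) = opT Q ν i h v := by
  have := DFunLike.congr_fun (opE_mul_opT_mul_opE (k := k) Q ν i h μ) v
  simpa only [Module.End.mul_apply, hv] using this

theorem freeRep_pev_of_ne (R : MvPolynomial (Fin 2) k) (x y : FA k I n) {μ : Fin n → I}
    {w : Equiv.Perm (Fin n)} (hw : col ν w ≠ μ) :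
    freeRep Q ν (pev R x y (E k μ)) (bas k w) = 0 := by
  rw [pev, map_sum, LinearMap.sum_apply]
  refine Finset.sum_eq_zero fun m _ => ?_
  rw [map_smul, map_mul, freeRep_E, LinearMap.smul_apply, Module.End.mul_apply,
    opE_bas_ne _ _ hw, map_zero, smul_zero]

theorem freeRep_pevDiff_of_ne (R : MvPolynomial (Fin 2) k) (x y z : FA k I n) {μ : Fin n → I}
    {w : Equiv.Perm (Fin n)} (hw : col ν w ≠ μ) :
    freeRep Q ν (pevDiff R x y z (E k μ)) (bas k w) = 0 := by
  rw [pevDiff, map_sum, LinearMap.sum_apply]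
  refine Finset.sum_eq_zero fun m _ => ?_
  rw [map_smul, map_mul, freeRep_E, LinearMap.smul_apply, Module.End.mul_apply,
    opE_bas_ne _ _ hw, map_zero, smul_zero]

theorem freeRep_tau_tau_bas {i j : ℕ} (hi : i + 1 < n) (hj : j + 1 < n)
    (w : Equiv.Perm (Fin n)) :
    freeRep Q ν (Tg k i hi (swapSeq j (col ν w)) * Tg k j hj (col ν w)) (bas k w) =
      opT Q ν i hi (opT Q ν j hj (bas k w)) := by
  simp only [map_mul, freeRep_Tg, Module.End.mul_apply, opE_bas _ _ rfl, opE_opT_bas]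

theorem freeRep_tau_tau_tau_bas {i j l : ℕ} (hi : i + 1 < n) (hj : j + 1 < n) (hl : l + 1 < n)
    (w : Equiv.Perm (Fin n)) :
    freeRep Q ν (Tg k i hi (swapSeq j (swapSeq l (col ν w))) * Tg k j hj (swapSeq l (col ν w)) *
      Tg k l hl (col ν w)) (bas k w) =
      opT Q ν i hi (opT Q ν j hj (opT Q ν l hl (bas k w))) := by
  simp only [map_mul, freeRep_Tg, Module.End.mul_apply, opE_bas _ _ rfl, opE_opT_bas,
    opE_opT_of_opE hj (opE_opT_bas Q ν l hl w)]

theorem freeRep_braid_eq (hQdiag : ∀ i, Q i i = 0) (hherm : Hermitian Q) {i : ℕ} (h : i + 2 < n)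
    (w : Equiv.Perm (Fin n)) (hv : col ν w ⟨i, by omega⟩ = col ν w ⟨i + 2, h⟩) :
    opT Q ν (i + 1) h (opT Q ν i (by omega) (opT Q ν (i + 1) h (bas k w))) =
      opT Q ν i (by omega) (opT Q ν (i + 1) h (opT Q ν i (by omega) (bas k w))) +
        evDiff (Q (col ν w ⟨i, by omega⟩) (col ν w ⟨i + 1, by omega⟩)) (w⁻¹ ⟨i, by omega⟩)
          (w⁻¹ ⟨i + 1, by omega⟩) (w⁻¹ ⟨i + 2, h⟩) • bas k w := by
  refine opT_braid h w fun a b c ha hb hc hab hac hbc => ?_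
  simp only [col, ← ha, ← hb, ← hc] at hv ⊢
  by_cases e : ν a = ν b
  · have e' : ν b = ν c := e.symm.trans hv
    rw [move_mul_move_of_eq hab e, move_mul_move_of_eq hbc e', e, hQdiag]
    have : evDiff (0 : MvPolynomial (Fin 2) k) a b c = 0 := by simp [evDiff]
    rw [this]
    linear_combination (stay k ν b c - stay k ν a b) * stay_relation (k := k) (ν := ν) hab hac hbc
  · have e' : ν b ≠ ν c := fun h => e (hv.trans h.symm)
    rw [move_mul_move_of_ne hherm e, move_mul_move_of_ne hherm e', stay_of_ne e, stay_of_ne e',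
      ev_hermitian hherm (ν b), ← hv]
    linear_combination (-evDiff (Q (ν a) (ν b)) a b c) * stay_mul_sub (k := k) hac hv -
      stay k ν a c * evDiff_mul (Q (ν a) (ν b)) a b c

theorem freeRep_braid_ne {i : ℕ} (h : i + 2 < n)
    (w : Equiv.Perm (Fin n)) (hv : col ν w ⟨i, by omega⟩ ≠ col ν w ⟨i + 2, h⟩) :
    opT Q ν (i + 1) h (opT Q ν i (by omega) (opT Q ν (i + 1) h (bas k w))) =
      opT Q ν i (by omega) (opT Q ν (i + 1) h (opT Q ν i (by omega) (bas k w))) := by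
  have := opT_braid (Q := Q) (ν := ν) h w (γ := 0) fun a b c ha hb hc hab hac hbc => ?_
  · simpa using this
  simp only [col, ← ha, ← hc] at hv
  rw [stay_of_ne hv]
  by_cases e : ν a = ν b
  · rw [stay_of_ne (a := b) (b := c) (fun h => hv (e.trans h))]
    ring
  · rw [stay_of_ne e]
    ring

theorem freeRep_tau_x {i : ℕ} (h : i + 1 < n) (a : Fin n) (w : Equiv.Perm (Fin n)) :
    freeRep Q ν (Tg k i h (col ν w) * Xg k a (col ν w)) (bas k w) =
      freeRep Q ν (Xg k (adj n i a) (swapSeq i (col ν w)) * Tg k i h (col ν w)) (bas k w) +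
        (stay k ν (w⁻¹ ⟨i, by omega⟩) (w⁻¹ ⟨i + 1, h⟩) *
          (yv k (w⁻¹ a) - yv k (w⁻¹ (adj n i a)))) • bas k w := by
  simp only [map_mul, freeRep_Tg, freeRep_Xg, Module.End.mul_apply, opE_bas _ _ rfl, opE_opT_bas,
    opX_bas, map_smul]
  rw [opT_bas]
  simp only [map_add, map_smul, opX_bas, adj_mul_inv_apply, adj_adj]
  module

theorem freeRep_rel (hQdiag : ∀ i, Q i i = 0) (hherm : Hermitian Q) (ν : Fin n → I)
    {x y : FA k I n} (hxy : Rel Q x y) : freeRep Q ν x = freeRep Q ν y := by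
  refine strands_end_ext fun w => ?_
  cases hxy with
  | unit_mul_self μ => simp only [map_mul, freeRep_E, opE_mul_self]
  | unit_mul_ne μ μ' h =>
    simp only [map_mul, freeRep_E, Module.End.mul_apply, map_zero, LinearMap.zero_apply]
    by_cases hw : col ν w = μ'
    · rw [opE_bas _ _ hw, opE_bas_ne _ _ (fun e => h (e.symm.trans hw))]
    · rw [opE_bas_ne _ _ hw, map_zero]
  | tau_sandwich i h μ =>
    simp only [map_mul, freeRep_E, freeRep_Tg, ← mul_assoc, opE_mul_opT_mul_opE]
    rw [mul_assoc, opE_mul_self]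
  | x_sandwich a μ =>
    simp only [map_mul, freeRep_E, freeRep_Xg, ← mul_assoc, opE_mul_opX]
    simp only [mul_assoc, opE_mul_self]
  | x_comm a b μ =>
    by_cases hw : col ν w = μ
    · simp only [map_mul, freeRep_Xg, Module.End.mul_apply, opE_bas _ _ hw, opX_bas, map_smul]
      rw [smul_comm]
    · simp only [map_mul, freeRep_Xg, Module.End.mul_apply, opE_bas_ne _ _ hw, map_zero]
  | tau_sq i h μ =>
    by_cases hw : col ν w = μ
    · subst hw
      rw [freeRep_tau_tau_bas, opT_opT_bas hQdiag hherm, freeRep_pev]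
    · rw [freeRep_pev_of_ne _ _ _ hw]
      simp only [map_mul, freeRep_Tg, Module.End.mul_apply, opE_bas_ne _ _ hw, map_zero]
  | tau_far i j hi hj hij μ =>
    by_cases hw : col ν w = μ
    · subst hw
      rw [freeRep_tau_tau_bas, freeRep_tau_tau_bas, opT_far hi hj hij]
    · simp only [map_mul, freeRep_Tg, Module.End.mul_apply, opE_bas_ne _ _ hw, map_zero]
  | braid_eq i h μ hv =>
    rw [map_add, LinearMap.add_apply]
    by_cases hw : col ν w = μ
    · subst hw
      rw [freeRep_tau_tau_tau_bas, freeRep_tau_tau_tau_bas, freeRep_pevDiff Q ν _ _ _ h,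
        freeRep_braid_eq hQdiag hherm h w hv]
    · rw [freeRep_pevDiff_of_ne _ _ _ _ hw]
      simp only [map_mul, freeRep_Tg, Module.End.mul_apply, opE_bas_ne _ _ hw, map_zero, add_zero]
  | braid_ne i h μ hv =>
    by_cases hw : col ν w = μ
    · subst hw
      rw [freeRep_tau_tau_tau_bas, freeRep_tau_tau_tau_bas, freeRep_braid_ne h w hv]
    · simp only [map_mul, freeRep_Tg, Module.End.mul_apply, opE_bas_ne _ _ hw, map_zero]
  | tau_x_i i h μ hv =>
    rw [map_sub, LinearMap.sub_apply, Xn, dif_pos (by omega : i < n), Xn, dif_pos h]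
    by_cases hw : col ν w = μ
    · subst hw
      rw [freeRep_tau_x, adj_left h, stay_mul_sub (by simp) (show ν _ = ν _ from hv), freeRep_E, opE_bas _ _ rfl]
      module
    · simp only [map_mul, freeRep_Tg, freeRep_Xg, freeRep_E, Module.End.mul_apply,
        opE_bas_ne _ _ hw, map_zero, sub_zero]
  | tau_x_i1 i h μ hv =>
    rw [map_add, LinearMap.add_apply, Xn, dif_pos h, Xn, dif_pos (by omega : i < n)]
    by_cases hw : col ν w = μ
    · subst hw
      rw [freeRep_tau_x, adj_right h, ← neg_sub, mul_neg, stay_mul_sub (by simp) (show ν _ = ν _ from hv), freeRep_E,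
        opE_bas _ _ rfl]
      module
    · simp only [map_mul, freeRep_Tg, freeRep_Xg, freeRep_E, Module.End.mul_apply,
        opE_bas_ne _ _ hw, map_zero, add_zero]
  | tau_x_other i h a μ hv =>
    by_cases hw : col ν w = μ
    · subst hw
      rw [freeRep_tau_x, adj_of_lt h]
      rcases hv with hv | hv
      · rw [Equiv.swap_apply_of_ne_of_ne (fun e => hv.1 (by rw [e])) (fun e => hv.2 (by rw [e]))]
        simp
      · rw [stay_of_ne (show ν _ ≠ ν _ from hv), zero_mul, zero_smul, add_zero]
    · simp only [map_mul, freeRep_Tg, freeRep_Xg, Module.End.mul_apply, opE_bas_ne _ _ hw,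
        map_zero]

/-- The action of `H_n(Q)` on arrangements of strands. -/
noncomputable def rep (hQdiag : ∀ i, Q i i = 0) (hherm : Hermitian Q) (ν : Fin n → I) :
    HQ k I n Q →ₐ[k] Module.End (FR k n) (Strands k n) :=
  RingQuot.liftAlgHom k ⟨freeRep Q ν, fun _ _ h => freeRep_rel hQdiag hherm ν h⟩

theorem rep_mk (hQdiag : ∀ i, Q i i = 0) (hherm : Hermitian Q) (ν : Fin n → I) (x : FA k I n) :
    rep hQdiag hherm ν (mk Q x) = freeRep Q ν x := by
  rw [rep, mk, RingQuot.liftAlgHom_mkAlgHom_apply]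

end Rouq

namespace Rouq

open MvPolynomial

variable {k : Type} [CommRing k] {I : Type} {n : ℕ}

variable {Q : I → I → MvPolynomial (Fin 2) k} (hQdiag : ∀ i, Q i i = 0) (hherm : Hermitian Q)
  (ν : Fin n → I)

theorem rep_hE (μ : Fin n → I) : rep hQdiag hherm ν (hE Q μ) = opE k ν μ := by
  rw [hE, rep_mk, freeRep_E]

theorem rep_hX (a : Fin n) (μ : Fin n → I) :
    rep hQdiag hherm ν (hX Q a μ) = opX k a * opE k ν μ := by
  rw [hX, rep_mk, freeRep_Xg]

theorem rep_hT {i : ℕ} (h : i + 1 < n) (μ : Fin n → I) :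
    rep hQdiag hherm ν (hT Q i μ) = opT Q ν i h * opE k ν μ := by
  rw [hT_of_lt h, rep_mk, freeRep_Tg]

theorem col_one : col ν 1 = ν := rfl

theorem rep_polyHom_bas (P : MvPolynomial (Fin n) k) (w : Equiv.Perm (Fin n)) :
    rep hQdiag hherm ν (polyHom Q (col ν w) P) (bas k w) =
      aeval (fun a => yv k (w⁻¹ a)) P • bas k w := by
  induction P using MvPolynomial.induction_on with
  | C c =>
    rw [← algebraMap_eq, AlgHom.commutes, AlgHom.commutes, AlgHom.commutes,
      Module.algebraMap_end_apply, algebraMap_smul]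
  | add p q hp hq => rw [map_add, map_add, LinearMap.add_apply, hp, hq, map_add, add_smul]
  | mul_X p a hp =>
    rw [map_mul, map_mul, polyHom_X, rep_hX, Module.End.mul_apply, Module.End.mul_apply,
      opE_bas _ _ rfl, opX_bas, map_smul, hp, map_mul, aeval_X, smul_smul, mul_comm]

theorem rep_phiNu_bas (P : MvPolynomial (Fin n) k) (w : Equiv.Perm (Fin n)) :
    rep hQdiag hherm ν (phiNu Q (col ν w) P) (bas k w) =
      aeval (fun a => yv k (w⁻¹ a)) P • bas k w := by
  rw [phiNu_eq, map_mul, Module.End.mul_apply, rep_hE, opE_bas _ _ rfl, rep_polyHom_bas]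

theorem rep_phiNu_bas_one (P : MvPolynomial (Fin n) k) :
    rep hQdiag hherm ν (phiNu Q ν P) (bas k 1) = algebraMap _ (FR k n) P • bas k 1 := by
  have : aeval (fun a => yv k ((1 : Equiv.Perm (Fin n))⁻¹ a)) P =
      algebraMap (MvPolynomial (Fin n) k) (FR k n) P := by
    have : (aeval fun a => yv k ((1 : Equiv.Perm (Fin n))⁻¹ a)) =
        IsScalarTower.toAlgHom k (MvPolynomial (Fin n) k) (FR k n) := by
      ext a
      simp [yv]
    rw [this]
    rfl
  rw [← this]
  exact rep_phiNu_bas hQdiag hherm ν P 1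

include hQdiag hherm in
theorem phiNu_injective : Function.Injective (phiNu Q ν) := by
  intro P R h
  have := congrArg (fun z => rep hQdiag hherm ν z (bas k 1) 1) h
  simp only [rep_phiNu_bas_one, Finsupp.smul_apply, Finsupp.single_eq_same, smul_eq_mul,
    mul_one] at this
  exact IsFractionRing.injective _ _ this

theorem isUnit_move {a b : Fin n} (h : a < b) : IsUnit (move Q ν a b) := by
  rw [move]
  split_ifs
  · exact IsUnit.of_mul_eq_one_right _ (mul_dinv h.ne)
  · exact isUnit_one

/-- A statistic of permutations decreasing with the number of inversions. -/
def weight (w : Equiv.Perm (Fin n)) : ℕ := ∑ a : Fin n, a.val * (w⁻¹ a).val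

theorem weight_lt {i : ℕ} (h : i + 1 < n) {w : Equiv.Perm (Fin n)}
    (hw : w⁻¹ ⟨i + 1, h⟩ < w⁻¹ ⟨i, by omega⟩) : weight w < weight (adj n i * w) := by
  have key : ((weight (adj n i * w) : ℕ) : ℤ) - weight w =
      (w⁻¹ ⟨i, by omega⟩).val - (w⁻¹ ⟨i + 1, h⟩).val := by
    simp only [weight, Nat.cast_sum, ← Finset.sum_sub_distrib]
    rw [Fintype.sum_eq_add (⟨i, by omega⟩ : Fin n) ⟨i + 1, h⟩ (by simp)]
    · simp only [adj_mul_inv_apply, adj_left h, adj_right h]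
      push_cast
      ring
    · rintro a ⟨h1, h2⟩
      rw [adj_mul_inv_apply, adj_apply_ne (fun e => h1 (Fin.ext e)) (fun e => h2 (Fin.ext e)),
        sub_self]
  have : (w⁻¹ ⟨i + 1, h⟩).val < (w⁻¹ ⟨i, by omega⟩).val := hw
  omega

theorem exists_descent {w : Equiv.Perm (Fin n)} (hw : w ≠ 1) :
    ∃ (i : ℕ) (h : i + 1 < n), w⁻¹ ⟨i + 1, h⟩ < w⁻¹ ⟨i, by omega⟩ := by
  by_contra! hc
  apply hw
  rcases n with _ | n
  · exact Subsingleton.elim _ _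
  have hmono : StrictMono (w⁻¹ : Equiv.Perm (Fin (n + 1))) := by
    rw [Fin.strictMono_iff_lt_succ]
    intro i
    exact lt_of_le_of_ne (hc i (by omega)) (fun e => by
      have := w⁻¹.injective e
      simp [Fin.ext_iff] at this)
  rw [← inv_eq_one]
  exact Equiv.coe_fn_injective ((hmono.range_inj strictMono_id).mp (by simp))

/-- The vectors reached from the initial arrangement. -/
noncomputable def reached : Submodule (FR k n) (Strands k n) :=
  Submodule.span (FR k n) (Set.range fun h => rep hQdiag hherm ν h (bas k 1))

theorem rep_mem_reached (h : HQ k I n Q) {v : Strands k n} (hv : v ∈ reached hQdiag hherm ν) :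
    rep hQdiag hherm ν h v ∈ reached hQdiag hherm ν := by
  induction hv using Submodule.span_induction with
  | mem x hx =>
    obtain ⟨g, rfl⟩ := hx
    exact Submodule.subset_span ⟨h * g, by simp⟩
  | zero => rw [map_zero]; exact zero_mem _
  | add x y _ _ hx hy => rw [map_add]; exact add_mem hx hy
  | smul c x _ hx => rw [map_smul]; exact Submodule.smul_mem _ _ hx

theorem bas_mem_reached (w : Equiv.Perm (Fin n)) : bas k w ∈ reached hQdiag hherm ν := by
  obtain ⟨N, hN⟩ : ∃ N, ∀ w : Equiv.Perm (Fin n), weight w ≤ N :=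
    ⟨∑ w : Equiv.Perm (Fin n), weight w, fun w =>
      Finset.single_le_sum (f := weight) (fun _ _ => Nat.zero_le _) (Finset.mem_univ w)⟩
  generalize hd : N - weight w = d
  induction d using Nat.strong_induction_on generalizing w with
  | _ d ih =>
    by_cases hw : w = 1
    · subst hw
      exact Submodule.subset_span ⟨1, by simp⟩
    · obtain ⟨i, h, hi⟩ := exists_descent hw
      have hlt := weight_lt h hi
      have hmem := ih _ (by have := hN (adj n i * w); omega) (adj n i * w) rfl
      have hT := rep_mem_reached hQdiag hherm ν (hT Q i (col ν (adj n i * w))) hmem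
      rw [rep_hT _ _ _ h, Module.End.mul_apply, opE_bas _ _ rfl, opT_bas, adj_mul_adj_mul,
        adj_mul_inv_apply, adj_mul_inv_apply, adj_left h, adj_right h] at hT
      have := (Submodule.add_mem_iff_left _ (Submodule.smul_mem _ _ hmem)).mp hT
      obtain ⟨u, hu⟩ := isUnit_move (Q := Q) ν hi
      rw [← hu] at this
      have := Submodule.smul_mem _ ((u⁻¹ : (FR k n)ˣ) : FR k n) this
      rwa [smul_smul, Units.inv_mul, one_smul] at this

theorem rep_bas_one_mem_span (h : HQ k I n Q) :
    ∃ P : List ℕ → MvPolynomial (Fin n) k,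
      h * hE Q ν = ∑ l ∈ nfSet n, hW Q l ν * phiNu Q ν (P l) ∧
      rep hQdiag hherm ν h (bas k 1) = ∑ l : nfSet n,
        algebraMap _ (FR k n) (P l) • rep hQdiag hherm ν (hW Q l ν) (bas k 1) := by
  obtain ⟨P, hP⟩ := exists_mul_hE_eq_sum h ν
  refine ⟨P, hP, ?_⟩
  have h1 : rep hQdiag hherm ν h (bas k 1) = rep hQdiag hherm ν (h * hE Q ν) (bas k 1) := by
    rw [map_mul, Module.End.mul_apply, rep_hE, opE_bas _ _ (col_one ν)]
  rw [h1, hP, map_sum, LinearMap.sum_apply, ← Finset.sum_coe_sort]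
  refine Finset.sum_congr rfl fun l _ => ?_
  rw [map_mul, Module.End.mul_apply, rep_phiNu_bas_one, map_smul]

theorem linearIndependent_rep_hW :
    LinearIndependent (FR k n) fun l : nfSet n => rep hQdiag hherm ν (hW Q l ν) (bas k 1) := by
  obtain ⟨j⟩ : Nonempty (nfSet n ↪ Equiv.Perm (Fin n)) := by
    rw [Function.Embedding.nonempty_iff_card_le]
    simpa [Fintype.card_perm] using card_nfSet_le n
  refine OrzechProperty.injective_of_surjective_of_injective
    (Finsupp.lmapDomain (FR k n) (FR k n) j) _ (Finsupp.mapDomain_injective j.injective) ?_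
  rw [← LinearMap.range_eq_top, eq_top_iff, Finsupp.range_linearCombination]
  have hle : reached hQdiag hherm ν ≤ Submodule.span (FR k n)
      (Set.range fun l : nfSet n => rep hQdiag hherm ν (hW Q l ν) (bas k 1)) := by
    rw [reached, Submodule.span_le]
    rintro _ ⟨h, rfl⟩
    obtain ⟨P, -, hP⟩ := rep_bas_one_mem_span hQdiag hherm ν h
    change rep hQdiag hherm ν h (bas k 1) ∈ _
    rw [hP]
    exact Submodule.sum_mem _ fun l _ => Submodule.smul_mem _ _ (Submodule.subset_span ⟨l, rfl⟩)
  intro v _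
  apply hle
  rw [← Finsupp.sum_single v]
  refine Submodule.sum_mem _ fun w _ => ?_
  have := Submodule.smul_mem _ (v w) (bas_mem_reached hQdiag hherm ν w)
  rwa [Finsupp.smul_single, smul_eq_mul, mul_one] at this

end Rouq

namespace Rouq

open MvPolynomial

variable {k : Type} [CommRing k] {I : Type} {n : ℕ}

variable {Q : I → I → MvPolynomial (Fin 2) k}

theorem hE_mem_Hgen (ν : Fin n → I) : hE Q ν ∈ Hgen Q :=
  NonUnitalAlgebra.subset_adjoin k ⟨Gen.unit ν, rfl⟩

theorem hX_mem_Hgen (a : Fin n) (ν : Fin n → I) : hX Q a ν ∈ Hgen Q :=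
  NonUnitalAlgebra.subset_adjoin k ⟨Gen.x a ν, rfl⟩

theorem hT_mem_Hgen (i : ℕ) (ν : Fin n → I) : hT Q i ν ∈ Hgen Q := by
  by_cases h : i + 1 < n
  · rw [hT_of_lt h]
    exact NonUnitalAlgebra.subset_adjoin k ⟨Gen.tau i h ν, rfl⟩
  · rw [hT_of_not_lt h]
    exact zero_mem _

theorem Hgen_induction {p : HQ k I n Q → Prop} (hE' : ∀ ν, p (hE Q ν)) (hX' : ∀ a ν, p (hX Q a ν))
    (hT' : ∀ i ν, p (hT Q i ν)) (zero : p 0) (add : ∀ x y, p x → p y → p (x + y))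
    (mul : ∀ x y, p x → p y → p (x * y)) (smul : ∀ (c : k) x, p x → p (c • x))
    {z : HQ k I n Q} (hz : z ∈ Hgen Q) : p z := by
  induction hz using NonUnitalAlgebra.adjoin_induction with
  | mem x hx =>
    obtain ⟨g, rfl⟩ := hx
    cases g with
    | unit ν => exact hE' ν
    | x a ν => exact hX' a ν
    | tau i h ν => simpa [hT_of_lt h] using! hT' i ν
  | zero => exact zero
  | add x y _ _ hx hy => exact add x y hx hy
  | mul x y _ _ hx hy => exact mul x y hx hy
  | smul c x _ hx => exact smul c x hx

theorem phiNu_mem_Hgen (ν : Fin n → I) (P : MvPolynomial (Fin n) k) : phiNu Q ν P ∈ Hgen Q := by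
  induction P using MvPolynomial.induction_on with
  | C c =>
    have : (C c : MvPolynomial (Fin n) k) = c • 1 := by rw [smul_eq_C_mul, mul_one]
    rw [this, phiNu_smul, phiNu_one]
    exact SMulMemClass.smul_mem c (hE_mem_Hgen ν)
  | add p q hp hq => rw [phiNu_add]; exact add_mem hp hq
  | mul_X p a hp => rw [phiNu_mul, phiNu_X]; exact mul_mem hp (hX_mem_Hgen a ν)

theorem Phi_mem_Hgen (f : (Fin n → I) →₀ MvPolynomial (Fin n) k) : Phi Q f ∈ Hgen Q :=
  sum_mem fun ν _ => phiNu_mem_Hgen ν (f ν)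

theorem Phi_mul_hE (f : (Fin n → I) →₀ MvPolynomial (Fin n) k) (ν : Fin n → I) :
    Phi Q f * hE Q ν = phiNu Q ν (f ν) := by
  rw [Phi, Finsupp.sum, Finset.sum_mul, Finset.sum_eq_single ν, phiNu_mul_hE]
  · exact fun μ _ h => phiNu_mul_hE_ne h _
  · intro h
    rw [Finsupp.notMem_support_iff.mp h, phiNu_zero, zero_mul]

theorem hE_mul_Phi (f : (Fin n → I) →₀ MvPolynomial (Fin n) k) (ν : Fin n → I) :
    hE Q ν * Phi Q f = phiNu Q ν (f ν) := by
  rw [Phi, Finsupp.sum, Finset.mul_sum, Finset.sum_eq_single ν, hE_mul_phiNu]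
  · exact fun μ _ h => hE_mul_phiNu_ne h.symm _
  · intro h
    rw [Finsupp.notMem_support_iff.mp h, phiNu_zero, mul_zero]

theorem Phi_injective (hQdiag : ∀ i, Q i i = 0) (hherm : Hermitian Q) :
    Function.Injective (Phi (n := n) Q) := by
  intro f g h
  ext1 ν
  apply phiNu_injective hQdiag hherm ν
  rw [← Phi_mul_hE, h, Phi_mul_hE]

theorem Phi_mul_hT {f : (Fin n → I) →₀ MvPolynomial (Fin n) k} (hf : SymInvariant f) (i : ℕ)
    (ν : Fin n → I) : Phi Q f * hT Q i ν = hT Q i ν * Phi Q f := by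
  by_cases h : i + 1 < n
  · have hs : rename (adj n i) (f ν) = f (swapSeq i ν) := by
      rw [← hf (adj n i) (swapSeq i ν), ← swapSeq_eq, swapSeq_swapSeq]
    obtain ⟨D, hD, hne, heq⟩ := hT_mul_phiNu (Q := Q) h ν (f ν)
    have hD0 : D = 0 := by
      by_cases hc : ν ⟨i, by omega⟩ = ν ⟨i + 1, h⟩
      · have := heq hc
        rw [hs, swapSeq_of_eq h hc, sub_self] at this
        exact (isRegular_X_sub_X (by simp)).left (this.trans (mul_zero _).symm)
      · exact hne hc
    calc Phi Q f * hT Q i ν = Phi Q f * hE Q (swapSeq i ν) * hT Q i ν := by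
          rw [mul_assoc, hE_mul_hT]
      _ = hT Q i ν * phiNu Q ν (f ν) := by
          rw [Phi_mul_hE, hD, hD0, phiNu_zero, add_zero, hs]
      _ = hT Q i ν * Phi Q f := by rw [← hE_mul_Phi, ← mul_assoc, hT_mul_hE]
  · rw [hT_of_not_lt h, mul_zero, zero_mul]

theorem Phi_mul_hX (f : (Fin n → I) →₀ MvPolynomial (Fin n) k) (a : Fin n)
    (ν : Fin n → I) : Phi Q f * hX Q a ν = hX Q a ν * Phi Q f := by
  rw [← hE_mul_hX, ← mul_assoc, Phi_mul_hE, hE_mul_hX, ← hX_mul_hE, mul_assoc, hE_mul_Phi,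
    hX_mul_hE, ← phiNu_X, ← phiNu_mul, ← phiNu_mul, mul_comm]

theorem Phi_central {f : (Fin n → I) →₀ MvPolynomial (Fin n) k} (hf : SymInvariant f)
    {h : HQ k I n Q} (hh : h ∈ Hgen Q) : Phi Q f * h = h * Phi Q f := by
  refine Hgen_induction (p := fun h => Phi Q f * h = h * Phi Q f) ?_ (Phi_mul_hX f)
    (Phi_mul_hT hf) ?_ ?_ ?_ ?_ hh
  · intro ν
    rw [Phi_mul_hE, hE_mul_Phi]
  · rw [mul_zero, zero_mul]
  · intro x y hx hy
    rw [mul_add, add_mul, hx, hy]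
  · intro x y hx hy
    rw [← mul_assoc, hx, mul_assoc, hy, mul_assoc]
  · intro c x hx
    rw [mul_smul_comm, smul_mul_assoc, hx]

theorem exists_finset_sum_mul_hE {z : HQ k I n Q} (hz : z ∈ Hgen Q) :
    ∃ S : Finset (Fin n → I), ∀ T, S ⊆ T → ∑ ν ∈ T, z * hE Q ν = z := by
  classical
  have gen : ∀ (g : HQ k I n Q) (ν : Fin n → I), g * hE Q ν = g →
      ∃ S : Finset (Fin n → I), ∀ T, S ⊆ T → ∑ μ ∈ T, g * hE Q μ = g := by
    intro g ν hg
    refine ⟨{ν}, fun T hT => ?_⟩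
    rw [Finset.sum_eq_single ν, hg]
    · intro μ _ hμ
      rw [← hg, mul_assoc, hE_mul_ne hμ.symm, mul_zero]
    · exact fun h => absurd (hT (Finset.mem_singleton_self ν)) h
  refine Hgen_induction (p := fun z => ∃ S : Finset (Fin n → I), ∀ T, S ⊆ T →
    ∑ ν ∈ T, z * hE Q ν = z) (fun ν => gen _ ν (hE_mul_self ν)) (fun a ν => gen _ ν (hX_mul_hE a ν))
    (fun i ν => gen _ ν (hT_mul_hE i ν)) ⟨∅, by simp⟩ ?_ ?_ ?_ hz
  · rintro x y ⟨S, hS⟩ ⟨S', hS'⟩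
    refine ⟨S ∪ S', fun T hT => ?_⟩
    simp only [add_mul, Finset.sum_add_distrib]
    rw [hS T (Finset.union_subset_left hT), hS' T (Finset.union_subset_right hT)]
  · rintro x y - ⟨S, hS⟩
    refine ⟨S, fun T hT => ?_⟩
    simp only [mul_assoc, ← Finset.mul_sum]
    rw [Finset.mul_sum, hS T hT]
  · rintro c x ⟨S, hS⟩
    refine ⟨S, fun T hT => ?_⟩
    simp only [smul_mul_assoc, ← Finset.smul_sum]
    rw [hS T hT]

theorem opX_apply (a : Fin n) (v : Strands k n) (w : Equiv.Perm (Fin n)) :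
    opX k a v w = yv k (w⁻¹ a) * v w := by
  induction v using Finsupp.induction_linear with
  | zero => simp
  | add x y hx hy => rw [map_add, Finsupp.add_apply, hx, hy, Finsupp.add_apply, mul_add]
  | single u c =>
    rw [opX, Finsupp.linearCombination_single]
    by_cases hu : u = w
    · subst hu; simp [mul_comm]
    · simp [hu]

theorem eq_zero_of_yv_sub_mul {a b : Fin n} (h : a ≠ b) {c : FR k n}
    (hc : yv k a * c = yv k b * c) : c = 0 := by
  linear_combination (-c) * mul_dinv (k := k) h + dinv k a b * hc

theorem exists_mul_hE_eq_phiNu (hQdiag : ∀ i, Q i i = 0) (hherm : Hermitian Q)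
    {z : HQ k I n Q} (hz : ∀ h ∈ Hgen Q, z * h = h * z) (ν : Fin n → I) :
    ∃ P, z * hE Q ν = phiNu Q ν P := by
  classical
  obtain ⟨P, hP, hrep⟩ := rep_bas_one_mem_span hQdiag hherm ν z
  set v := rep hQdiag hherm ν z (bas k 1) with hv
  have hvE : opE k ν ν v = v := by
    rw [hv, ← rep_hE hQdiag hherm, ← Module.End.mul_apply, ← map_mul, ← hz _ (hE_mem_Hgen ν),
      map_mul, Module.End.mul_apply, rep_hE, opE_bas _ _ (col_one ν)]
  have hvX : ∀ a, opX k a v = yv k a • v := fun a => by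
    conv_lhs => rw [← hvE, ← Module.End.mul_apply, ← rep_hX hQdiag hherm, hv,
      ← Module.End.mul_apply, ← map_mul, ← hz _ (hX_mem_Hgen a ν), map_mul, Module.End.mul_apply,
      rep_hX, Module.End.mul_apply, opE_bas _ _ (col_one ν), opX_bas, map_smul]
    rfl
  have hsupp : v = v 1 • bas k 1 := by
    ext w
    by_cases hw : w = 1
    · subst hw; simp
    · obtain ⟨a, ha⟩ : ∃ a, w⁻¹ a ≠ a := by
        by_contra! hc
        exact hw (inv_eq_one.mp (Equiv.ext hc))
      have := DFunLike.congr_fun (hvX a) w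
      rw [opX_apply, Finsupp.smul_apply, smul_eq_mul] at this
      rw [eq_zero_of_yv_sub_mul ha this]
      simp [Ne.symm hw]
  have hli := Fintype.linearIndependent_iff.mp (linearIndependent_rep_hW hQdiag hherm ν)
    (fun l => algebraMap _ (FR k n) (P l) - if l = ⟨[], nil_mem_nfSet n⟩ then v 1 else 0) (by
      simp only [sub_smul, Finset.sum_sub_distrib, ite_smul, zero_smul, Finset.sum_ite_eq',
        Finset.mem_univ, if_true]
      rw [← hrep, hW_nil, rep_hE, opE_bas _ _ (col_one ν), ← hsupp, sub_self])
  refine ⟨P [], ?_⟩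
  rw [hP, Finset.sum_eq_single [], hW_nil, hE_mul_phiNu]
  · intro l hl hne
    have := hli ⟨l, hl⟩
    rw [if_neg (by simpa using hne), sub_zero, map_eq_zero_iff _ (IsFractionRing.injective _ _)]
      at this
    rw [this, phiNu_zero, mul_zero]
  · exact fun h => absurd (nil_mem_nfSet n) h

theorem rep_phiNu_apply (hQdiag : ∀ i, Q i i = 0) (hherm : Hermitian Q) (ν : Fin n → I)
    (P : MvPolynomial (Fin n) k) (v : Strands k n) (w : Equiv.Perm (Fin n)) :
    rep hQdiag hherm ν (phiNu Q (col ν w) P) v w = aeval (fun a => yv k (w⁻¹ a)) P * v w := by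
  induction v using Finsupp.induction_linear with
  | zero => simp
  | add x y hx hy => rw [map_add, Finsupp.add_apply, hx, hy, Finsupp.add_apply, mul_add]
  | single u c =>
    have hs : Finsupp.single u c = c • bas k u := by simp
    rw [hs, map_smul, Finsupp.smul_apply, Finsupp.smul_apply]
    by_cases hu : col ν u = col ν w
    · rw [← hu, rep_phiNu_bas, Finsupp.smul_apply]
      by_cases e : u = w
      · subst e
        simp [mul_comm]
      · simp [e]
    · have e : u ≠ w := fun e => hu (by rw [e])
      rw [phiNu_eq, map_mul, Module.End.mul_apply, rep_hE, opE_bas_ne _ _ hu, map_zero]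
      simp [e]

theorem aeval_yv_perm_injective (σ : Equiv.Perm (Fin n)) {P : MvPolynomial (Fin n) k}
    (h : aeval (fun a => yv k (σ a)) P = 0) : P = 0 := by
  have : (aeval fun a => yv k (σ a)) =
      (IsScalarTower.toAlgHom k (MvPolynomial (Fin n) k) (FR k n)).comp (rename σ) := by
    ext a
    simp [yv]
  rw [this, AlgHom.comp_apply] at h
  have h' : algebraMap _ (FR k n) (rename σ P) = 0 := h
  rw [map_eq_zero_iff _ (IsFractionRing.injective _ _)] at h'
  exact (map_eq_zero_iff _ (rename_injective _ σ.injective)).mp h'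

theorem rename_adj_of_central (hQdiag : ∀ i, Q i i = 0) (hherm : Hermitian Q)
    {z : HQ k I n Q} (hz : ∀ h ∈ Hgen Q, z * h = h * z)
    {p : (Fin n → I) → MvPolynomial (Fin n) k} (hp : ∀ ν, z * hE Q ν = phiNu Q ν (p ν))
    {i : ℕ} (h : i + 1 < n) (ν : Fin n → I) :
    rename (adj n i) (p ν) = p (swapSeq i ν) := by
  obtain ⟨D, hD, -, -⟩ := hT_mul_phiNu (Q := Q) h ν (p ν)
  have h1 : hT Q i ν * phiNu Q ν (p ν) = phiNu Q (swapSeq i ν) (p (swapSeq i ν)) * hT Q i ν := by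
    rw [← hp, ← hp, hz _ (hE_mem_Hgen ν), ← mul_assoc, hT_mul_hE, mul_assoc, hE_mul_hT,
      hz _ (hT_mem_Hgen i ν)]
  have h2 : phiNu Q (swapSeq i ν) (rename (adj n i) (p ν) - p (swapSeq i ν)) * hT Q i ν +
      phiNu Q ν D = 0 := by
    rw [phiNu_sub, sub_mul, ← h1, hD]
    abel
  have hne : adj n i ≠ 1 := fun e => by
    have := adj_left h
    rw [e] at this
    simp at this
  have h3 := congrArg (fun y => rep hQdiag hherm ν y (bas k 1) (adj n i)) h2
  have hcol : swapSeq i ν = col ν (adj n i) := by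
    rw [← mul_one (adj n i), col_adj_mul, col_one]
  simp only [map_add, map_mul, LinearMap.add_apply, Module.End.mul_apply, Finsupp.add_apply,
    map_zero, LinearMap.zero_apply, Finsupp.zero_apply, rep_phiNu_bas_one] at h3
  nth_rewrite 1 [hcol] at h3
  rw [rep_phiNu_apply, rep_hT _ _ _ h, Module.End.mul_apply, opE_bas _ _ (col_one ν), opT_bas,
    mul_one] at h3
  simp only [Finsupp.add_apply, Finsupp.smul_apply, Finsupp.single_eq_same,
    Finsupp.single_eq_of_ne hne, smul_eq_mul, mul_zero, add_zero, mul_one] at h3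
  rw [(isUnit_move (Q := Q) ν (show (1 : Equiv.Perm (Fin n))⁻¹ ⟨i, by omega⟩ <
    (1 : Equiv.Perm (Fin n))⁻¹ ⟨i + 1, h⟩ by simp)).mul_left_eq_zero] at h3
  exact sub_eq_zero.mp (aeval_yv_perm_injective _ h3)

theorem rename_of_rename_adj {p : (Fin n → I) → MvPolynomial (Fin n) k}
    (hp : ∀ i, i + 1 < n → ∀ ν, rename (adj n i) (p ν) = p (swapSeq i ν))
    (σ : Equiv.Perm (Fin n)) : ∀ ν, rename σ (p (ν ∘ σ)) = p ν := by
  rcases n with _ | n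
  · intro ν
    have : σ = 1 := Subsingleton.elim _ _
    subst this
    simp
  have hσ : σ ∈ Submonoid.closure
      (Set.range fun i : Fin n => Equiv.swap i.castSucc i.succ) := by
    rw [Equiv.Perm.mclosure_swap_castSucc_succ]
    trivial
  induction hσ using Submonoid.closure_induction with
  | mem x hx =>
    obtain ⟨i, rfl⟩ := hx
    intro ν
    have : Equiv.swap i.castSucc i.succ = adj (n + 1) i := (adj_of_lt (by omega)).symm
    simp only [this]
    rw [← swapSeq_eq, hp i (by omega), swapSeq_swapSeq]
  | one => intro ν; simp
  | mul x y _ _ hx hy =>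
    intro ν
    have := hy (ν ∘ x)
    rw [← hx ν, ← this, rename_rename]
    rfl

theorem exists_Phi_eq (hQdiag : ∀ i, Q i i = 0) (hherm : Hermitian Q)
    {z : HQ k I n Q} (hz : z ∈ Hgen Q) (hcomm : ∀ h ∈ Hgen Q, z * h = h * z) :
    ∃ f, SymInvariant f ∧ Phi Q f = z := by
  choose p hp using exists_mul_hE_eq_phiNu hQdiag hherm hcomm
  obtain ⟨S, hS⟩ := exists_finset_sum_mul_hE hz
  have hpS : ∀ ν, p ν ≠ 0 → ν ∈ S := by
    intro ν hν
    by_contra hn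
    apply hν
    apply phiNu_injective hQdiag hherm ν
    rw [← hp, phiNu_zero, ← hS S subset_rfl, Finset.sum_mul]
    refine Finset.sum_eq_zero fun μ hμ => ?_
    rw [mul_assoc, hE_mul_ne (fun e : μ = ν => hn (e ▸ hμ)), mul_zero]
  refine ⟨Finsupp.onFinset S p hpS, fun σ ν => ?_, ?_⟩
  · exact rename_of_rename_adj
      (fun i h ν => rename_adj_of_central hQdiag hherm hcomm hp h ν) σ ν
  · rw [Phi, Finsupp.onFinset_sum _ (fun ν => phiNu_zero ν)]
    simp only [← hp]
    exact hS S subset_rfl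

end Rouq

open Rouq in
/-- If `Q` is hermitian then `φ : R_n → H_n(Q)` is injective
on the `S_n`-invariants, and its image on the invariants is exactly the center
of `H_n(Q)`. -/
theorem statement1 (k : Type) [CommRing k] (I : Type) (n : ℕ) (hn : 1 ≤ n)
    (Q : I → I → MvPolynomial (Fin 2) k) (hQdiag : ∀ i, Q i i = 0)
    (hherm : Hermitian Q) :
    Set.InjOn (Phi Q) {f : (Fin n → I) →₀ MvPolynomial (Fin n) k | SymInvariant f} ∧
    Phi Q '' {f : (Fin n → I) →₀ MvPolynomial (Fin n) k | SymInvariant f}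
      = {z : HQ k I n Q | z ∈ Hgen Q ∧ ∀ h ∈ Hgen Q, z * h = h * z} := by
  refine ⟨(Phi_injective hQdiag hherm).injOn, Set.Subset.antisymm ?_ ?_⟩
  · rintro _ ⟨f, hf, rfl⟩
    exact ⟨Phi_mem_Hgen f, fun h hh => Phi_central hf hh⟩
  · rintro z ⟨hz, hcomm⟩
    exact exists_Phi_eq hQdiag hherm hz hcomm
end

section
/- Let n ≥ 1 and let ⁰H_n be the nil affine Hecke algebra of GL_n: the Z-algebra generated by X_1,…,X_n and T_1,…,T_{n−1} with relations: the X_a pairwise commute; T_iT_{i+1}T_i = T_{i+1}T_iT_{i+1}; T_iT_j = T_jT_i for |i−j| > 1; T_i² = 0; T_iX_j = X_jT_i for j ≠ i, i+1; T_iX_{i+1} − X_iT_i = 1; T_iX_i − X_{i+1}T_i = −1. Then the assignment X_a ↦ (multiplication by X_a) and T_i ↦ ∂_i defines a ring homomorphism from ⁰H_n to End_{Z[X_1,…,X_n]^{S_n}}(Z[X_1,…,X_n]), the ring of endomorphisms of Z[X_1,…,X_n] that are linear over the subring of symmetric polynomials, and this homomorphism is bijective. Consequently, since Z[X_1,…,X_n]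 is a free Z[X_1,…,X_n]^{S_n}-module of rank n!, the ring ⁰H_n is isomorphic to the ring of n!×n! matrices over Z[X_1,…,X_n]^{S_n}. -/
open scoped BigOperators

namespace Dem

/-- The polynomial ring `ℤ[X_1, …, X_n]` (0-based variables). -/
abbrev R (n : ℕ) := MvPolynomial (Fin n) ℤ

/-- `D` is the family of Demazure (BGG) operators `∂_i` (0-based), characterized
by `(X_{i+1} - X_i) · ∂_i P = P - s_i(P)`. -/
def IsDemFamily {n : ℕ} (D : ℕ → R n → R n) : Prop :=
  ∀ (i : ℕ) (h : i + 1 < n) (P : R n),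
    (MvPolynomial.X (⟨i + 1, h⟩ : Fin n) - MvPolynomial.X ⟨i, by omega⟩) * D i P
      = P - MvPolynomial.rename (Equiv.swap (⟨i, by omega⟩ : Fin n) ⟨i + 1, h⟩) P

/-- `∂_w = ∂_{i_1} ∘ ⋯ ∘ ∂_{i_r}` for a word `l = [i_1, …, i_r]` (rightmost
applied first). -/
def applyWord {n : ℕ} (D : ℕ → R n → R n) (l : List ℕ) (P : R n) : R n :=
  l.foldr (fun i Q => D i Q) P

/-- The permutation of `Fin n` given by a word in the simple transpositions. -/
def permOfWord (n : ℕ) (l : List ℕ) : Equiv.Perm (Fin n) :=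
  (l.map fun i =>
    if h : i + 1 < n then Equiv.swap (⟨i, by omega⟩ : Fin n) ⟨i + 1, h⟩ else 1).prod

/-- `l` is a reduced word for the permutation `w`. -/
def IsReducedWordFor (n : ℕ) (l : List ℕ) (w : Equiv.Perm (Fin n)) : Prop :=
  (∀ i ∈ l, i + 1 < n) ∧ permOfWord n l = w ∧
    ∀ l' : List ℕ, (∀ i ∈ l', i + 1 < n) → permOfWord n l' = w → l.length ≤ l'.length

/-- The standard reduced word for the longest element of `S_m` (0-based). -/
def longWord (m : ℕ) : List ℕ :=
  (List.range m).foldr (fun j acc => (List.range j).reverse ++ acc) []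

/-- The set of variables `X_{lo+1}, …, X_n` (0-based indices `≥ lo`). -/
def varsFrom (n lo : ℕ) : Finset (Fin n) :=
  Finset.univ.filter fun a : Fin n => lo ≤ a.val

/-- The set of variables `X_1, …, X_m` (0-based indices `< m`). -/
def varsUpto (n m : ℕ) : Finset (Fin n) :=
  Finset.univ.filter fun a : Fin n => a.val < m

/-- Elementary symmetric polynomial of degree `m` in the variables of `s`. -/
noncomputable def eOn {n : ℕ} (s : Finset (Fin n)) (m : ℕ) : R n :=
  ∑ T ∈ s.powersetCard m, ∏ a ∈ T, MvPolynomial.X a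

/-- Complete homogeneous symmetric polynomial of degree `j` in the variables of
`s`. -/
noncomputable def hOn {n : ℕ} (s : Finset (Fin n)) (j : ℕ) : R n :=
  ∑ d ∈ s.sym j, (Multiset.map MvPolynomial.X (d : Multiset (Fin n))).prod

/-- `P` is symmetric in the variables with (0-based) index `≥ lo`. -/
def SymFrom {n : ℕ} (lo : ℕ) (P : R n) : Prop :=
  ∀ a b : Fin n, lo ≤ a.val → lo ≤ b.val →
    MvPolynomial.rename (Equiv.swap a b) P = P

/-- The monomial symmetric polynomial in the first `c` of the `n` variables,
attached to the exponent vector `w` (the sum of the distinct monomials in the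
`S_c`-orbit of `X_1^{w_1} ⋯ X_c^{w_c}`). -/
noncomputable def msymBlock {n : ℕ} (c : ℕ) (w : Fin c → ℕ) : R n :=
  ∑ g ∈ Finset.image
      (fun σ : Equiv.Perm (Fin c) =>
        fun i : Fin n => if h : i.val < c then w (σ ⟨i.val, h⟩) else 0)
      Finset.univ,
    ∏ i, MvPolynomial.X i ^ g i

end Dem

namespace Dem

/-- Generators of the nil affine Hecke algebra `⁰H_n` of `GL_n`. -/
inductive NGen (n : ℕ) : Type
  | X (a : Fin n) : NGen n
  | T (i : ℕ) (h : i + 1 < n) : NGen n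

abbrev NF (n : ℕ) := FreeAlgebra ℤ (NGen n)

def nX {n : ℕ} (a : Fin n) : NF n := FreeAlgebra.ι ℤ (NGen.X a)

def nT {n : ℕ} (i : ℕ) (h : i + 1 < n) : NF n := FreeAlgebra.ι ℤ (NGen.T i h)

/-- Defining relations of the nil affine Hecke algebra `⁰H_n`. -/
inductive NRel (n : ℕ) : NF n → NF n → Prop
  | x_comm (a b : Fin n) : NRel n (nX a * nX b) (nX b * nX a)
  | braid (i : ℕ) (h : i + 2 < n) :
      NRel n (nT i (by omega) * nT (i + 1) (by omega) * nT i (by omega))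
        (nT (i + 1) (by omega) * nT i (by omega) * nT (i + 1) (by omega))
  | far (i j : ℕ) (hi : i + 1 < n) (hj : j + 1 < n) (hij : i + 2 ≤ j) :
      NRel n (nT i hi * nT j hj) (nT j hj * nT i hi)
  | t_sq (i : ℕ) (h : i + 1 < n) : NRel n (nT i h * nT i h) 0
  | t_x_far (i : ℕ) (h : i + 1 < n) (a : Fin n) (ha : a.val ≠ i ∧ a.val ≠ i + 1) :
      NRel n (nT i h * nX a) (nX a * nT i h)
  | t_x1 (i : ℕ) (h : i + 1 < n) :
      NRel n (nT i h * nX ⟨i + 1, h⟩ - nX ⟨i, by omega⟩ * nT i h) 1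
  | t_x2 (i : ℕ) (h : i + 1 < n) :
      NRel n (nT i h * nX ⟨i, by omega⟩ - nX ⟨i + 1, h⟩ * nT i h) (-1)

/-- The nil affine Hecke algebra `⁰H_n` of `GL_n`. -/
abbrev NH (n : ℕ) := RingQuot (NRel n)

/-- The ring of endomorphisms of `ℤ[X_1,…,X_n]` linear over the subring of
symmetric polynomials. -/
abbrev SymEnd (n : ℕ) :=
  Module.End ↥(MvPolynomial.symmetricSubalgebra (Fin n) ℤ) (R n)

/-- Multiplication by `X_a`, as an endomorphism linear over the symmetric
polynomials. -/
noncomputable def mulXEnd {n : ℕ} (a : Fin n) : SymEnd n :=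
  Algebra.lmul ↥(MvPolynomial.symmetricSubalgebra (Fin n) ℤ) (R n) (MvPolynomial.X a)

end Dem

namespace Dem

/-- Two sequences `x`, `t` in a ring satisfying the defining relations of the nil affine Hecke
algebra of `GL_n`, where only the inhomogeneous relations are restricted to indices below `n`. -/
structure NilHeckeFamily {A : Type*} [Ring A] (n : ℕ) (x t : ℕ → A) : Prop where
  x_comm : ∀ a b, x a * x b = x b * x a
  braid : ∀ i, t i * t (i + 1) * t i = t (i + 1) * t i * t (i + 1)
  far : ∀ i j, i + 2 ≤ j → t i * t j = t j * t i
  t_sq : ∀ i, t i * t i = 0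
  t_x_far : ∀ i a, a ≠ i → a ≠ i + 1 → t i * x a = x a * t i
  t_x1 : ∀ i, i + 1 < n → t i * x (i + 1) - x i * t i = 1
  t_x2 : ∀ i, i + 1 < n → t i * x i - x (i + 1) * t i = -1

/-- The product `t 0 * t 1 * ⋯ * t (m - 1)`. -/
def cycleProd {A : Type*} [Ring A] (t : ℕ → A) : ℕ → A
  | 0 => 1
  | m + 1 => cycleProd t m * t m

/-- The element `T_{w₀}` attached to the longest element of `S_m`. -/
def longElt {A : Type*} [Ring A] (t : ℕ → A) : ℕ → A
  | 0 => 1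
  | m + 1 => cycleProd t m * longElt t m

/-- The composite of the commuting operators `w ↦ y * w - w * x i` for `i < m`. -/
def iterBracket {A : Type*} [Ring A] (x : ℕ → A) (y : A) : ℕ → (A →+ A)
  | 0 => AddMonoidHom.id A
  | m + 1 => (iterBracket x y m).comp (AddMonoidHom.mulLeft y - AddMonoidHom.mulRight (x m))

section NilHeckeFamily

variable {A : Type*} [Ring A] {n : ℕ} {x t : ℕ → A}

theorem iterBracket_succ_apply (x : ℕ → A) (y : A) (m : ℕ) (w : A) :
    iterBracket x y (m + 1) w = iterBracket x y m (y * w - w * x m) := rfl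

theorem iterBracket_mul_right {y u : A} {m : ℕ} (hu : ∀ i < m, u * x i = x i * u) (w : A) :
    iterBracket x y m (w * u) = iterBracket x y m w * u := by
  induction m generalizing w with
  | zero => rfl
  | succ m ih =>
    rw [iterBracket_succ_apply, iterBracket_succ_apply, ← ih fun i hi => hu i (by omega),
      mul_assoc w u, hu m (by omega)]
    congr 1
    noncomm_ring

theorem exists_iterBracket_eq_sum (x : ℕ → A) (y : A) (m : ℕ) :
    ∃ β : ℕ → A, ∀ w, iterBracket x y m w = ∑ j ∈ Finset.range (m + 1), y ^ j * w * β j := by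
  induction m with
  | zero => exact ⟨fun _ => 1, fun w => by simp [iterBracket]⟩
  | succ m ih =>
    obtain ⟨β, hβ⟩ := ih
    refine ⟨fun j => (if j = 0 then 0 else β (j - 1)) - (if j = m + 1 then 0 else x m * β j),
      fun w => ?_⟩
    rw [iterBracket_succ_apply, hβ]
    simp only [mul_sub, sub_mul, Finset.sum_sub_distrib]
    congr 1
    · conv_rhs => rw [Finset.sum_range_succ']
      simp [pow_succ, mul_assoc]
    · rw [Finset.sum_range_succ _ (m + 1)]
      simp only [if_true, mul_zero, add_zero]
      refine Finset.sum_congr rfl fun j hj => ?_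
      rw [if_neg (by have := Finset.mem_range.1 hj; omega)]
      simp only [mul_assoc]

namespace NilHeckeFamily

theorem t_cycleProd_comm (H : NilHeckeFamily n x t) {m i : ℕ} (h : m < i) :
    t i * cycleProd t m = cycleProd t m * t i := by
  induction m with
  | zero => simp [cycleProd]
  | succ m ih =>
    rw [cycleProd, ← mul_assoc, ih (by omega), mul_assoc, ← H.far m i (by omega), mul_assoc]

theorem x_cycleProd_comm (H : NilHeckeFamily n x t) {m i : ℕ} (h : m < i) :
    x i * cycleProd t m = cycleProd t m * x i := by
  induction m with
  | zero => simp [cycleProd]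
  | succ m ih =>
    rw [cycleProd, ← mul_assoc, ih (by omega), mul_assoc,
      ← H.t_x_far m i (by omega) (by omega), mul_assoc]

theorem t_zero_mul_cycleProd (H : NilHeckeFamily n x t) (m : ℕ) :
    t 0 * cycleProd t (m + 1) = 0 := by
  induction m with
  | zero => simp [cycleProd, H.t_sq]
  | succ m ih => rw [cycleProd, ← mul_assoc, ih, zero_mul]

theorem t_succ_mul_cycleProd (H : NilHeckeFamily n x t) {m i : ℕ} (h : i + 1 < m) :
    t (i + 1) * cycleProd t m = cycleProd t m * t i := by
  induction m with
  | zero => omega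
  | succ m ih =>
    rcases Nat.lt_or_ge (i + 1) m with h' | h'
    · rw [cycleProd, ← mul_assoc, ih h', mul_assoc, H.far i m (by omega), mul_assoc]
    · obtain rfl : m = i + 1 := by omega
      simp only [cycleProd]
      rw [← mul_assoc, ← mul_assoc, H.t_cycleProd_comm (by omega), mul_assoc, mul_assoc,
        ← mul_assoc (t (i + 1)), ← H.braid]
      simp only [mul_assoc]

/-- `T_i T_{w₀} = 0`. -/
theorem t_mul_longElt (H : NilHeckeFamily n x t) {m i : ℕ} (h : i + 1 < m) :
    t i * longElt t m = 0 := by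
  induction m generalizing i with
  | zero => omega
  | succ m ih =>
    rw [longElt, ← mul_assoc]
    rcases i with _ | i
    · obtain ⟨k, rfl⟩ : ∃ k, m = k + 1 := ⟨m - 1, by omega⟩
      rw [H.t_zero_mul_cycleProd, zero_mul]
    · rw [H.t_succ_mul_cycleProd (by omega), mul_assoc, ih (by omega), mul_zero]

theorem iterBracket_mul_t (H : NilHeckeFamily n x t) {y : A} {m k : ℕ} (hk : k + 1 < m)
    (hm : m ≤ n) (w : A) :
    iterBracket x y m (w * t k) = iterBracket x y m w * t k := by
  induction m generalizing w with
  | zero => omega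
  | succ m ih =>
    rcases Nat.lt_or_ge (k + 1) m with h' | h'
    · rw [iterBracket_succ_apply, iterBracket_succ_apply, ← ih h' (by omega), mul_assoc w,
        H.t_x_far k m (by omega) (by omega)]
      congr 1
      noncomm_ring
    · obtain rfl : m = k + 1 := by omega
      have h1 := H.t_x1 k (by omega)
      have h2 := H.t_x2 k (by omega)
      have h3 := H.x_comm k (k + 1)
      have h4 : t k * x (k + 1) = 1 + x k * t k := by rw [← h1]; abel
      have h5 : t k * x k = -1 + x (k + 1) * t k := by rw [← h2]; abel
      rw [iterBracket_succ_apply, iterBracket_succ_apply, iterBracket_succ_apply,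
        iterBracket_succ_apply, ← iterBracket_mul_right
          fun i hi => H.t_x_far k i (by omega) (by omega)]
      congr 1
      simp only [mul_sub, sub_mul, mul_assoc, h4, h5, mul_add, add_mul, mul_neg, mul_one]
      rw [← mul_assoc (x (k + 1)), ← h3]
      simp only [mul_assoc]
      abel

theorem iterBracket_mul_longElt (H : NilHeckeFamily n x t) {y : A} {m : ℕ} (hm : m ≤ n) (w : A) :
    iterBracket x y m (w * longElt t m) = iterBracket x y m w * longElt t m := by
  have hcyc : ∀ k < m, ∀ w, iterBracket x y m (w * cycleProd t k)
      = iterBracket x y m w * cycleProd t k := by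
    intro k
    induction k with
    | zero => simp [cycleProd]
    | succ k ih =>
      intro hk w
      rw [cycleProd, ← mul_assoc, H.iterBracket_mul_t hk hm, ih (by omega), mul_assoc]
  have hlong : ∀ k ≤ m, ∀ w, iterBracket x y m (w * longElt t k)
      = iterBracket x y m w * longElt t k := by
    intro k
    induction k with
    | zero => simp [longElt]
    | succ k ih =>
      intro hk w
      rw [longElt, ← mul_assoc, ih (by omega), hcyc k (by omega), mul_assoc]
  exact hlong m le_rfl w

theorem iterBracket_cycleProd_mul_longElt (H : NilHeckeFamily n x t) {m k : ℕ} (hm : m < n)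
    (hk : k < m) :
    iterBracket x (x m) k (cycleProd t k) * longElt t m = longElt t m := by
  induction k with
  | zero => simp [iterBracket, cycleProd]
  | succ k ih =>
    have h2 := H.t_x2 k (by omega)
    have h5 : t k * x k = -1 + x (k + 1) * t k := by rw [← h2]; abel
    have : x m * cycleProd t (k + 1) - cycleProd t (k + 1) * x k
        = cycleProd t k + (x m * cycleProd t k - cycleProd t k * x (k + 1)) * t k := by
      rw [cycleProd, mul_assoc (cycleProd t k), h5]
      noncomm_ring
    rw [iterBracket_succ_apply, this, map_add, iterBracket_mul_right
      (fun i hi => H.t_x_far k i (by omega) (by omega)), add_mul, ih (by omega), mul_assoc,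
      H.t_mul_longElt hk, mul_zero, add_zero]

theorem iterBracket_longElt_succ (H : NilHeckeFamily n x t) {m : ℕ} (hm : m < n) :
    iterBracket x (x m) m (longElt t (m + 1)) = longElt t m := by
  rw [longElt, H.iterBracket_mul_longElt hm.le]
  rcases m with _ | k
  · simp [iterBracket, cycleProd]
  · have h2 := H.t_x2 k (by omega)
    have h5 : t k * x k = -1 + x (k + 1) * t k := by rw [← h2]; abel
    have : x (k + 1) * cycleProd t (k + 1) - cycleProd t (k + 1) * x k = cycleProd t k := by
      rw [cycleProd, mul_assoc (cycleProd t k), h5, ← mul_assoc, H.x_cycleProd_comm (by omega)]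
      noncomm_ring
    rw [iterBracket_succ_apply, this, H.iterBracket_cycleProd_mul_longElt hm (by omega)]

/-- `T_{w₀}` for `S_m` is a combination of translates of `T_{w₀}` for `S_{m+1}`. -/
theorem exists_longElt_eq_sum (H : NilHeckeFamily n x t) {m : ℕ} (hm : m < n) :
    ∃ β : ℕ → A, longElt t m = ∑ j ∈ Finset.range (m + 1), x m ^ j * longElt t (m + 1) * β j := by
  obtain ⟨β, hβ⟩ := exists_iterBracket_eq_sum x (x m) m
  exact ⟨β, by rw [← hβ, H.iterBracket_longElt_succ hm]⟩

end NilHeckeFamily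

end NilHeckeFamily

section Demazure

open MvPolynomial

theorem braid_aux {S : Type*} [CommRing S] [IsDomain S] {s₁ s₂ : S →+* S} {x y z : S}
    (hxy : y - x ≠ 0) (h1x : s₁ x = y) (h1y : s₁ y = x) (h1z : s₁ z = z)
    (h2x : s₂ x = x) (h2y : s₂ y = z) {P Q₁ Q₂ Q₃ : S}
    (e1 : (y - x) * Q₁ = P - s₁ P) (e2 : (z - y) * Q₂ = Q₁ - s₂ Q₁)
    (e3 : (y - x) * Q₃ = Q₂ - s₁ Q₂) (hinv : s₁ (s₁ P) = P) :
    (y - x) * (z - y) * (z - x) * Q₃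
      = P - s₁ P - s₂ P + s₁ (s₂ P) + s₂ (s₁ P) - s₁ (s₂ (s₁ P)) := by
  have f1 := congrArg s₁ e1
  have f2 := congrArg s₁ e2
  have f3 := congrArg s₂ e1
  have f4 := congrArg s₁ f3
  simp only [map_mul, map_sub, h1x, h1y, h1z, h2x, h2y, hinv] at f1 f2 f3 f4
  have hQ : s₁ Q₁ = Q₁ := mul_left_cancel₀ hxy (by linear_combination -f1 - e1)
  rw [hQ] at f2
  linear_combination (z - y) * (z - x) * e3 + (z - x) * e2 - (z - y) * f2 - f3 + f4 + e1

theorem X_sub_X_ne_zero {n : ℕ} {a b : Fin n} (h : a ≠ b) : (X a - X b : R n) ≠ 0 :=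
  sub_ne_zero.2 fun e => h (X_injective e)

/-- `p` is symmetric in the variables of index `< m`. -/
def SymUpto {n : ℕ} (m : ℕ) (p : R n) : Prop :=
  ∀ a b : Fin n, a.val < m → b.val < m → rename (Equiv.swap a b) p = p

theorem SymUpto.eq_zero_of_sum_mul_X_pow {n m : ℕ} (hm : m < n) {c : ℕ → R n}
    (hc : ∀ j, SymUpto (m + 1) (c j))
    (h : ∑ j ∈ Finset.range (m + 1), c j * X ⟨m, hm⟩ ^ j = 0) :
    ∀ j < m + 1, c j = 0 := by
  let q : Polynomial (R n) := ∑ j ∈ Finset.range (m + 1), Polynomial.monomial j (c j)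
  have hdeg : q.natDegree < m + 1 := by
    refine Nat.lt_succ_of_le (Polynomial.natDegree_sum_le_of_forall_le _ _ fun j hj => ?_)
    exact (Polynomial.natDegree_monomial_le _).trans (by have := Finset.mem_range.1 hj; omega)
  have hq : q = 0 := by
    refine Polynomial.eq_zero_of_natDegree_lt_card_of_eval_eq_zero q
      (f := fun i : Fin (m + 1) => (X (⟨i.val, by omega⟩ : Fin n) : R n)) ?_ ?_
      (by simpa using hdeg)
    · intro i j hij
      have := X_injective hij
      simpa [Fin.ext_iff] using this
    · intro i
      have := congrArg (rename (Equiv.swap (⟨i.val, by omega⟩ : Fin n) ⟨m, hm⟩)) h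
      simp only [map_sum, map_mul, map_pow, rename_X, Equiv.swap_apply_right, map_zero] at this
      rw [Polynomial.eval_finsetSum]
      simp only [Polynomial.eval_monomial]
      rw [← this]
      refine Finset.sum_congr rfl fun j _ => ?_
      rw [hc j _ _ i.2 (Nat.lt_succ_self m)]
  intro j hj
  have := congrArg (fun p => Polynomial.coeff p j) hq
  simpa [q, Polynomial.finsetSum_coeff, Polynomial.coeff_monomial, hj] using this

theorem isSymmetric_of_adjacent {n : ℕ} {p : R n}
    (hp : ∀ (i : ℕ) (h : i + 1 < n),
      rename (Equiv.swap (⟨i, by omega⟩ : Fin n) ⟨i + 1, h⟩) p = p) : p.IsSymmetric := by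
  intro e
  rcases n with _ | n
  · rw [Subsingleton.elim e 1]
    exact rename_id_apply p
  · have he : e ∈ Submonoid.closure
        (Set.range fun i : Fin n => Equiv.swap i.castSucc i.succ) := by
      rw [Equiv.Perm.mclosure_swap_castSucc_succ]; trivial
    induction he using Submonoid.closure_induction with
    | mem e he =>
      obtain ⟨i, rfl⟩ := he
      exact hp i.val (by omega)
    | one => exact rename_id_apply p
    | mul e f _ _ he hf =>
      rw [Equiv.Perm.coe_mul, ← rename_rename, hf, he]

namespace IsDemFamily

variable {n : ℕ} {D : ℕ → R n → R n}

theorem eq_iff (hD : IsDemFamily D) {i : ℕ} (h : i + 1 < n) {P Q : R n} :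
    D i P = Q ↔ (X (⟨i + 1, h⟩ : Fin n) - X ⟨i, by omega⟩) * Q
      = P - rename (Equiv.swap (⟨i, by omega⟩ : Fin n) ⟨i + 1, h⟩) P := by
  rw [← hD i h P, mul_right_inj' (X_sub_X_ne_zero (by simp)), eq_comm]

theorem map_mul (hD : IsDemFamily D) {i : ℕ} (h : i + 1 < n) (P Q : R n) :
    D i (P * Q)
      = D i P * Q + rename (Equiv.swap (⟨i, by omega⟩ : Fin n) ⟨i + 1, h⟩) P * D i Q := by
  rw [hD.eq_iff h, _root_.map_mul]
  linear_combination Q * hD i h P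
    + rename (Equiv.swap (⟨i, by omega⟩ : Fin n) ⟨i + 1, h⟩) P * hD i h Q

theorem apply_X_far (hD : IsDemFamily D) {i : ℕ} (h : i + 1 < n) {a : Fin n}
    (ha : a.val ≠ i) (ha' : a.val ≠ i + 1) : D i (X a) = 0 := by
  rw [hD.eq_iff h, rename_X, Equiv.swap_apply_of_ne_of_ne (by simpa [Fin.ext_iff] using ha)
    (by simpa [Fin.ext_iff] using ha')]
  ring

theorem apply_X_succ (hD : IsDemFamily D) {i : ℕ} (h : i + 1 < n) :
    D i (X ⟨i + 1, h⟩) = 1 := by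
  rw [hD.eq_iff h, rename_X, Equiv.swap_apply_right]
  ring

theorem apply_X_self (hD : IsDemFamily D) {i : ℕ} (h : i + 1 < n) :
    D i (X ⟨i, by omega⟩) = -1 := by
  rw [hD.eq_iff h, rename_X, Equiv.swap_apply_left]
  ring

theorem apply_C (hD : IsDemFamily D) {i : ℕ} (h : i + 1 < n) (c : ℤ) : D i (C c) = 0 := by
  rw [hD.eq_iff h, rename_C]
  ring

theorem rename_eq_of_apply_eq_zero (hD : IsDemFamily D) {i : ℕ} (h : i + 1 < n) {P : R n}
    (hP : D i P = 0) : rename (Equiv.swap (⟨i, by omega⟩ : Fin n) ⟨i + 1, h⟩) P = P := by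
  have := hD i h P
  rw [hP, mul_zero] at this
  exact (sub_eq_zero.1 this.symm).symm

theorem rename_swap_swap (a b : Fin n) (P : R n) :
    rename (Equiv.swap a b) (rename (Equiv.swap a b) P) = P := by
  rw [rename_rename, ← Equiv.Perm.coe_mul, Equiv.swap_mul_self]
  exact rename_id_apply P

theorem apply_apply (hD : IsDemFamily D) {i : ℕ} (h : i + 1 < n) (P : R n) :
    D i (D i P) = 0 := by
  rw [hD.eq_iff h, mul_zero, eq_comm, sub_eq_zero]
  have h1 := hD i h P
  have h2 := congrArg (rename (Equiv.swap (⟨i, by omega⟩ : Fin n) ⟨i + 1, h⟩)) h1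
  simp only [_root_.map_mul, map_sub, rename_X, Equiv.swap_apply_left, Equiv.swap_apply_right,
    rename_swap_swap] at h2
  exact mul_left_cancel₀ (X_sub_X_ne_zero (a := ⟨i + 1, h⟩) (b := ⟨i, by omega⟩) (by simp))
    (by linear_combination h1 + h2)

theorem comm (hD : IsDemFamily D) {i j : ℕ} (hi : i + 1 < n) (hj : j + 1 < n) (hij : i + 2 ≤ j)
    (P : R n) : D i (D j P) = D j (D i P) := by
  have key : ∀ Q : R n, rename (Equiv.swap (⟨i, by omega⟩ : Fin n) ⟨i + 1, hi⟩)
      (rename (Equiv.swap (⟨j, by omega⟩ : Fin n) ⟨j + 1, hj⟩) Q)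
      = rename (Equiv.swap (⟨j, by omega⟩ : Fin n) ⟨j + 1, hj⟩)
        (rename (Equiv.swap (⟨i, by omega⟩ : Fin n) ⟨i + 1, hi⟩) Q) := by
    intro Q
    rw [rename_rename, rename_rename]
    congr 2
    rw [← Equiv.Perm.coe_mul, ← Equiv.Perm.coe_mul, (Equiv.Perm.Disjoint.commute ?_).eq]
    rw [Equiv.Perm.disjoint_iff_disjoint_support, Equiv.Perm.support_swap (by simp),
      Equiv.Perm.support_swap (by simp)]
    simp [Fin.ext_iff]
    omega
  rw [hD.eq_iff hi]
  refine mul_left_cancel₀ (X_sub_X_ne_zero (a := ⟨j + 1, hj⟩) (b := ⟨j, by omega⟩) (by simp)) ?_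
  have e1 := hD j hj P
  have e2 := hD i hi P
  have e3 := hD j hj (D i P)
  have e4 := congrArg (rename (Equiv.swap (⟨i, by omega⟩ : Fin n) ⟨i + 1, hi⟩)) e1
  have e5 := congrArg (rename (Equiv.swap (⟨j, by omega⟩ : Fin n) ⟨j + 1, hj⟩)) e2
  have sw : ∀ {a b c : Fin n}, c ≠ a → c ≠ b → (rename (Equiv.swap a b) (X c) : R n) = X c :=
    fun h h' => by rw [rename_X, Equiv.swap_apply_of_ne_of_ne h h']
  simp only [_root_.map_mul, map_sub] at e4 e5
  rw [sw (by simp [Fin.ext_iff]; omega) (by simp [Fin.ext_iff]; omega),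
    sw (by simp [Fin.ext_iff]; omega) (by simp [Fin.ext_iff]; omega), key] at e4
  rw [sw (by simp [Fin.ext_iff]; omega) (by simp [Fin.ext_iff]; omega),
    sw (by simp [Fin.ext_iff]; omega) (by simp [Fin.ext_iff]; omega)] at e5
  linear_combination (X ⟨i + 1, hi⟩ - X ⟨i, by omega⟩) * e3 + e2 - e5 - e1 + e4

theorem braid (hD : IsDemFamily D) {i : ℕ} (h : i + 2 < n) (P : R n) :
    D i (D (i + 1) (D i P)) = D (i + 1) (D i (D (i + 1) P)) := by
  obtain ⟨a, ha⟩ : ∃ a : Fin n, a = ⟨i, by omega⟩ := ⟨_, rfl⟩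
  obtain ⟨b, hb⟩ : ∃ b : Fin n, b = ⟨i + 1, by omega⟩ := ⟨_, rfl⟩
  obtain ⟨c, hc⟩ : ∃ c : Fin n, c = ⟨i + 2, h⟩ := ⟨_, rfl⟩
  have hab : a ≠ b := by simp [ha, hb]
  have hbc : b ≠ c := by simp [hb, hc]
  have hac : a ≠ c := by simp [ha, hc]
  have h1 : ∀ Q, (X b - X a) * D i Q = Q - rename (Equiv.swap a b) Q := by
    rw [ha, hb]; exact hD i (by omega)
  have h2 : ∀ Q, (X c - X b) * D (i + 1) Q = Q - rename (Equiv.swap b c) Q := by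
    rw [hb, hc]; exact hD (i + 1) (by omega)
  have s1a : (rename (Equiv.swap a b) (X a) : R n) = X b := by
    rw [rename_X, Equiv.swap_apply_left]
  have s1b : (rename (Equiv.swap a b) (X b) : R n) = X a := by
    rw [rename_X, Equiv.swap_apply_right]
  have s1c : (rename (Equiv.swap a b) (X c) : R n) = X c := by
    rw [rename_X, Equiv.swap_apply_of_ne_of_ne hac.symm hbc.symm]
  have s2b : (rename (Equiv.swap b c) (X b) : R n) = X c := by
    rw [rename_X, Equiv.swap_apply_left]
  have s2c : (rename (Equiv.swap b c) (X c) : R n) = X b := by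
    rw [rename_X, Equiv.swap_apply_right]
  have s2a : (rename (Equiv.swap b c) (X a) : R n) = X a := by
    rw [rename_X, Equiv.swap_apply_of_ne_of_ne hab hac]
  have key : rename (Equiv.swap a b) (rename (Equiv.swap b c) (rename (Equiv.swap a b) P))
      = rename (Equiv.swap b c) (rename (Equiv.swap a b) (rename (Equiv.swap b c) P)) := by
    simp only [rename_rename, ← Equiv.Perm.coe_mul]
    rw [← mul_assoc, ← mul_assoc, Equiv.swap_mul_swap_mul_swap hab hac, Equiv.swap_comm a b,
      Equiv.swap_comm b c, Equiv.swap_mul_swap_mul_swap hbc.symm hac.symm, Equiv.swap_comm]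
  have k1 := braid_aux (s₁ := (rename (Equiv.swap a b) : R n →ₐ[ℤ] R n).toRingHom)
    (s₂ := (rename (Equiv.swap b c) : R n →ₐ[ℤ] R n).toRingHom)
    (X_sub_X_ne_zero hab.symm) s1a s1b s1c s2a s2b (h1 P) (h2 _) (h1 _)
    (rename_swap_swap a b P)
  have k2 := braid_aux (s₁ := (rename (Equiv.swap b c) : R n →ₐ[ℤ] R n).toRingHom)
    (s₂ := (rename (Equiv.swap a b) : R n →ₐ[ℤ] R n).toRingHom)
    (P := P) (Q₁ := -D (i + 1) P) (Q₂ := D i (D (i + 1) P)) (Q₃ := -D (i + 1) (D i (D (i + 1) P)))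
    (X_sub_X_ne_zero hbc) s2c s2b s2a s1c s1b
    (by linear_combination h2 P)
    (by rw [map_neg]; linear_combination -h1 (D (i + 1) P))
    (by linear_combination h2 (D i (D (i + 1) P)))
    (rename_swap_swap b c P)
  refine mul_left_cancel₀ (mul_ne_zero (mul_ne_zero (X_sub_X_ne_zero hab.symm)
    (X_sub_X_ne_zero hbc.symm)) (X_sub_X_ne_zero hac.symm)) ?_
  rw [k1]
  simp only [AlgHom.toRingHom_eq_coe, RingHom.coe_coe] at k2 ⊢
  rw [key]
  linear_combination -k2

end IsDemFamily

/-- The longest element `T_{w₀}` of `S_m` provides `m!` polynomials, linearly independent over the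
polynomials symmetric in the first `m` variables, and a resolution of the identity. -/
theorem NilHeckeFamily.exists_resolution {A : Type*} [Ring A] {n : ℕ} {x t : ℕ → A}
    (H : NilHeckeFamily n x t) (ι : R n →+* A) (hι : ∀ a : Fin n, ι (X a) = x a) {m : ℕ}
    (hm : m ≤ n) :
    ∃ (K : Type) (_ : Fintype K) (a : K → R n) (b : K → A), Fintype.card K = Nat.factorial m ∧
      ∑ k, ι (a k) * longElt t m * b k = 1 ∧
      ∀ c : K → R n, (∀ k, SymUpto m (c k)) → ∑ k, c k * a k = 0 → ∀ k, c k = 0 := by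
  induction m with
  | zero => exact ⟨Unit, inferInstance, 1, 1, by simp, by simp [longElt], fun c _ h k => by
      simpa using h⟩
  | succ m ih =>
    obtain ⟨K, _, a, b, hcard, hone, hind⟩ := ih (by omega)
    obtain ⟨β, hβ⟩ := H.exists_longElt_eq_sum (m := m) (by omega)
    refine ⟨K × Fin (m + 1), inferInstance, fun k => a k.1 * X ⟨m, hm⟩ ^ k.2.val,
      fun k => β k.2 * b k.1, ?_, ?_, fun c hc h k => ?_⟩
    · rw [Fintype.card_prod, hcard, Fintype.card_fin, Nat.factorial_succ, mul_comm]
    · rw [← hone, Fintype.sum_prod_type]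
      refine Finset.sum_congr rfl fun k _ => ?_
      rw [hβ, Finset.sum_range, Finset.mul_sum, Finset.sum_mul]
      refine Finset.sum_congr rfl fun j _ => ?_
      simp only [_root_.map_mul, map_pow, hι, mul_assoc]
    · let c' : K → ℕ → R n := fun k j => if hj : j < m + 1 then c (k, ⟨j, hj⟩) else 0
      have hc' : ∀ k j, SymUpto (m + 1) (c' k j) := fun k j => by
        by_cases hj : j < m + 1
        · simp only [c', dif_pos hj]; exact hc _
        · simp only [c', dif_neg hj]; exact fun _ _ _ _ => map_zero _
      have h0 := hind (fun k => ∑ j ∈ Finset.range (m + 1), c' k j * X ⟨m, hm⟩ ^ j) ?_ ?_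
      · have := SymUpto.eq_zero_of_sum_mul_X_pow hm (hc' k.1) (h0 k.1) k.2 k.2.2
        simpa only [c', dif_pos k.2.2] using this
      · intro k u v hu hv
        simp only [map_sum, _root_.map_mul, map_pow, rename_X]
        refine Finset.sum_congr rfl fun j _ => ?_
        rw [hc' k j u v (by omega) (by omega), Equiv.swap_apply_of_ne_of_ne]
        · simp only [ne_eq, Fin.ext_iff]; omega
        · simp only [ne_eq, Fin.ext_iff]; omega
      · rw [← h, Fintype.sum_prod_type]
        refine Finset.sum_congr rfl fun k _ => ?_
        rw [Finset.sum_range, Finset.sum_mul]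
        refine Finset.sum_congr rfl fun j _ => ?_
        simp only [c', j.2, dif_pos, Fin.eta]
        ring

end Demazure

section NilHecke

open MvPolynomial

open scoped IsMulCommutative in
theorem exists_ringHom_X_eq {A : Type*} [Ring A] {n : ℕ} (x : Fin n → A)
    (hx : ∀ a b, x a * x b = x b * x a) : ∃ ι : R n →+* A, ∀ a, ι (X a) = x a := by
  have hcomm : ∀ u ∈ Set.range x, ∀ v ∈ Set.range x, u * v = v * u := by
    rintro _ ⟨a, rfl⟩ _ ⟨b, rfl⟩
    exact hx a b
  have := Algebra.isMulCommutative_adjoin ℤ hcomm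
  let g : R n →ₐ[ℤ] Algebra.adjoin ℤ (Set.range x) :=
    aeval fun a => ⟨x a, Algebra.subset_adjoin ⟨a, rfl⟩⟩
  exact ⟨((Algebra.adjoin ℤ (Set.range x)).val.comp g).toRingHom, fun a => by simp [g]⟩

section Resolution

variable {A : Type*} [Ring A] {n : ℕ} {f : A →+* SymEnd n} {ι : R n →+* A} {τ : A}
  {K : Type*} [Fintype K] {a : K → R n} {b : K → A}

theorem SymEnd.map_isSymmetric_mul (φ : SymEnd n) {c : R n} (hc : c.IsSymmetric) (p : R n) :
    φ (c * p) = c * φ p :=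
  φ.map_smul ⟨c, hc⟩ p

theorem sum_mul_apply_eq (hfι : ∀ p q, f (ι p) q = p * q) (hone : ∑ k, ι (a k) * τ * b k = 1)
    (p : R n) : ∑ k, a k * f τ (f (b k) p) = p := by
  have := congrArg (fun z => f z p) hone
  simpa [LinearMap.sum_apply, Module.End.mul_apply, hfι] using this

theorem bijective_of_resolution (hfι : ∀ p q, f (ι p) q = p * q)
    (hkey : ∀ z p, z * ι p * τ = ι (f z p) * τ) (hsym : ∀ p, (f τ p).IsSymmetric)
    (hone : ∑ k, ι (a k) * τ * b k = 1) : Function.Bijective f := by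
  constructor
  · rw [injective_iff_map_eq_zero]
    intro z hz
    rw [← mul_one z, ← hone, Finset.mul_sum]
    refine Finset.sum_eq_zero fun k _ => ?_
    rw [← mul_assoc, ← mul_assoc, hkey, hz]
    simp
  · intro φ
    refine ⟨∑ k, ι (φ (a k)) * τ * b k, LinearMap.ext fun p => ?_⟩
    conv_rhs => rw [← sum_mul_apply_eq hfι hone p]
    simp only [map_sum, LinearMap.sum_apply, map_mul, Module.End.mul_apply, hfι]
    refine Finset.sum_congr rfl fun k _ => ?_
    rw [mul_comm (a k), SymEnd.map_isSymmetric_mul φ (hsym _), mul_comm]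

theorem nonempty_basis_of_resolution (hfι : ∀ p q, f (ι p) q = p * q)
    (hsym : ∀ p, (f τ p).IsSymmetric) (hone : ∑ k, ι (a k) * τ * b k = 1)
    (hind : ∀ c : K → R n, (∀ k, SymUpto n (c k)) → ∑ k, c k * a k = 0 → ∀ k, c k = 0) :
    Nonempty (Module.Basis K (symmetricSubalgebra (Fin n) ℤ) (R n)) := by
  refine ⟨Module.Basis.mk (v := a) ?_ ?_⟩
  · rw [Fintype.linearIndependent_iff]
    intro g hg k
    exact Subtype.ext (hind (fun k => (g k).val) (fun k _ _ _ _ => (g k).2 _) hg k)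
  · intro p _
    rw [← sum_mul_apply_eq hfι hone p]
    refine Submodule.sum_mem _ fun k _ => ?_
    rw [mul_comm]
    exact Submodule.smul_mem _ (⟨_, hsym _⟩ : symmetricSubalgebra (Fin n) ℤ)
      (Submodule.subset_span ⟨k, rfl⟩)

end Resolution

/-- The generators `X_a` of `⁰H_n`, extended by zero to all indices. -/
noncomputable def xSeq (n i : ℕ) : NH n :=
  if h : i < n then RingQuot.mkRingHom (NRel n) (nX ⟨i, h⟩) else 0

/-- The generators `T_i` of `⁰H_n`, extended by zero to all indices. -/
noncomputable def tSeq (n i : ℕ) : NH n :=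
  if h : i + 1 < n then RingQuot.mkRingHom (NRel n) (nT i h) else 0

theorem xSeq_of_lt {n i : ℕ} (h : i < n) :
    xSeq n i = RingQuot.mkRingHom (NRel n) (nX ⟨i, h⟩) := dif_pos h

theorem tSeq_of_lt {n i : ℕ} (h : i + 1 < n) :
    tSeq n i = RingQuot.mkRingHom (NRel n) (nT i h) := dif_pos h

theorem xSeq_of_ge {n i : ℕ} (h : ¬ i < n) : xSeq n i = 0 := dif_neg h

theorem tSeq_of_ge {n i : ℕ} (h : ¬ i + 1 < n) : tSeq n i = 0 := dif_neg h

theorem nilHeckeFamily_seq (n : ℕ) : NilHeckeFamily n (xSeq n) (tSeq n) where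
  x_comm a b := by
    by_cases ha : a < n
    · by_cases hb : b < n
      · rw [xSeq_of_lt ha, xSeq_of_lt hb, ← map_mul, ← map_mul]
        exact RingQuot.mkRingHom_rel (NRel.x_comm _ _)
      · rw [xSeq_of_ge hb, mul_zero, zero_mul]
    · rw [xSeq_of_ge ha, mul_zero, zero_mul]
  braid i := by
    by_cases h : i + 2 < n
    · rw [tSeq_of_lt (by omega : i + 1 < n), tSeq_of_lt h]
      simp only [← map_mul]
      exact RingQuot.mkRingHom_rel (NRel.braid i h)
    · rw [tSeq_of_ge (i := i + 1) h, mul_zero, zero_mul, zero_mul]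
  far i j hij := by
    by_cases hj : j + 1 < n
    · rw [tSeq_of_lt (by omega : i + 1 < n), tSeq_of_lt hj, ← map_mul, ← map_mul]
      exact RingQuot.mkRingHom_rel (NRel.far i j _ hj hij)
    · rw [tSeq_of_ge hj, mul_zero, zero_mul]
  t_sq i := by
    by_cases h : i + 1 < n
    · rw [tSeq_of_lt h, ← map_mul, RingQuot.mkRingHom_rel (NRel.t_sq i h), map_zero]
    · rw [tSeq_of_ge h, mul_zero]
  t_x_far i a ha ha' := by
    by_cases h : i + 1 < n
    · by_cases hn : a < n
      · rw [tSeq_of_lt h, xSeq_of_lt hn, ← map_mul, ← map_mul]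
        exact RingQuot.mkRingHom_rel (NRel.t_x_far i h _ ⟨ha, ha'⟩)
      · rw [xSeq_of_ge hn, mul_zero, zero_mul]
    · rw [tSeq_of_ge h, mul_zero, zero_mul]
  t_x1 i h := by
    rw [tSeq_of_lt h, xSeq_of_lt h, xSeq_of_lt (by omega : i < n), ← map_mul, ← map_mul,
      ← map_sub, RingQuot.mkRingHom_rel (NRel.t_x1 i h), map_one]
  t_x2 i h := by
    rw [tSeq_of_lt h, xSeq_of_lt h, xSeq_of_lt (by omega : i < n), ← map_mul, ← map_mul,
      ← map_sub, RingQuot.mkRingHom_rel (NRel.t_x2 i h), map_neg, map_one]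

theorem exists_polynomialRep {n : ℕ} {D : ℕ → SymEnd n} (hD : IsDemFamily fun i P => D i P) :
    ∃ f : NH n →+* SymEnd n,
      (∀ a : Fin n, f (RingQuot.mkRingHom (NRel n) (nX a)) = mulXEnd a) ∧
      ∀ (i : ℕ) (h : i + 1 < n), f (RingQuot.mkRingHom (NRel n) (nT i h)) = D i := by
  let g : NGen n → SymEnd n
    | .X a => mulXEnd a
    | .T i _ => D i
  let F : NF n →+* SymEnd n := (FreeAlgebra.lift ℤ g).toRingHom
  have hX : ∀ a, F (nX a) = mulXEnd a := fun a => FreeAlgebra.lift_ι_apply g _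
  have hT : ∀ i h, F (nT i h) = D i := fun i h => FreeAlgebra.lift_ι_apply g _
  have hmul : ∀ (a : Fin n) (p : R n), mulXEnd a p = X a * p := fun _ _ => rfl
  have hF : ∀ u v, NRel n u v → F u = F v := by
    intro u v huv
    refine LinearMap.ext fun p => ?_
    induction huv with
    | x_comm a b => simp only [map_mul, hX, Module.End.mul_apply, hmul]; ring
    | braid i h => simp only [map_mul, hT, Module.End.mul_apply]; exact hD.braid h p
    | far i j hi hj hij => simp only [map_mul, hT, Module.End.mul_apply]; exact hD.comm hi hj hij p
    | t_sq i h =>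
      simp only [map_mul, hT, Module.End.mul_apply, map_zero, LinearMap.zero_apply]
      exact hD.apply_apply h p
    | t_x_far i h a ha =>
      simp only [map_mul, hT, hX, Module.End.mul_apply, hmul]
      refine (hD.map_mul h _ _).trans ?_
      rw [hD.apply_X_far h ha.1 ha.2, rename_X, Equiv.swap_apply_of_ne_of_ne
        (by simpa [Fin.ext_iff] using ha.1) (by simpa [Fin.ext_iff] using ha.2)]
      ring
    | t_x1 i h =>
      simp only [map_mul, map_sub, map_one, hT, hX, Module.End.mul_apply, hmul,
        LinearMap.sub_apply, Module.End.one_apply]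
      refine (congrArg (· - _) (hD.map_mul h _ _)).trans ?_
      rw [hD.apply_X_succ h, rename_X, Equiv.swap_apply_right]
      ring
    | t_x2 i h =>
      simp only [map_mul, map_sub, map_one, map_neg, hT, hX, Module.End.mul_apply, hmul,
        LinearMap.sub_apply, Module.End.one_apply, LinearMap.neg_apply]
      refine (congrArg (· - _) (hD.map_mul h _ _)).trans ?_
      rw [hD.apply_X_self h, rename_X, Equiv.swap_apply_left]
      ring
  refine ⟨RingQuot.lift ⟨F, fun {_ _} h => hF _ _ h⟩, fun a => ?_, fun i h => ?_⟩
  · rw [RingQuot.lift_mkRingHom_apply, hX]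
  · rw [RingQuot.lift_mkRingHom_apply, hT]

theorem tSeq_mul_map {n : ℕ} {D : ℕ → R n → R n} (hD : IsDemFamily D)
    (hadd : ∀ i p q, D i (p + q) = D i p + D i q)
    {ι : R n →+* NH n} (hι : ∀ a : Fin n, ι (X a) = xSeq n a) {i : ℕ} (h : i + 1 < n) (p : R n) :
    tSeq n i * ι p
      = ι (rename (Equiv.swap (⟨i, by omega⟩ : Fin n) ⟨i + 1, h⟩) p) * tSeq n i + ι (D i p) := by
  have H := nilHeckeFamily_seq n
  have hXa : ∀ a : Fin n, tSeq n i * ι (X a)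
      = ι (rename (Equiv.swap (⟨i, by omega⟩ : Fin n) ⟨i + 1, h⟩) (X a)) * tSeq n i
        + ι (D i (X a)) := by
    intro a
    rw [rename_X]
    by_cases ha : a.val = i
    · rw [show a = ⟨i, by omega⟩ from Fin.ext ha, Equiv.swap_apply_left, hι, hι, hD.apply_X_self h,
        map_neg, map_one, ← H.t_x2 i h]
      abel
    by_cases ha' : a.val = i + 1
    · rw [show a = ⟨i + 1, h⟩ from Fin.ext ha', Equiv.swap_apply_right, hι, hι, hD.apply_X_succ h,
        map_one, ← H.t_x1 i h]
      abel
    rw [Equiv.swap_apply_of_ne_of_ne (by simpa [Fin.ext_iff] using ha)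
      (by simpa [Fin.ext_iff] using ha'), hι, hD.apply_X_far h ha ha', map_zero, add_zero,
      H.t_x_far i a ha ha']
  induction p using MvPolynomial.induction_on with
  | C c =>
    rw [hD.apply_C h, rename_C, map_zero, add_zero, eq_intCast C c, map_intCast]
    exact (Int.cast_commute c _).eq.symm
  | add p q hp hq => rw [map_add, mul_add, hp, hq, map_add, hadd, map_add, map_add, add_mul]; abel
  | mul_X p a hp =>
    rw [hD.map_mul h, map_mul, ← mul_assoc, hp, add_mul, mul_assoc, hXa, map_mul, map_mul,
      map_add, map_mul, map_mul]
    noncomm_ring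

end NilHecke

end Dem

set_option synthInstance.maxHeartbeats 1000000 in
open Dem in
/-- The assignment `X_a ↦ (X_a · -)`, `T_i ↦ ∂_i` defines a
ring homomorphism `⁰H_n → End_{ℤ[X]^{S_n}}(ℤ[X])` which is bijective;
consequently `⁰H_n` is isomorphic to the ring of `n! × n!` matrices over
`ℤ[X]^{S_n}`. -/
theorem statement5 (n : ℕ) (hn : 1 ≤ n)
    (D : ℕ → SymEnd n)
    (hD : ∀ (i : ℕ) (h : i + 1 < n) (P : R n),
      (MvPolynomial.X (⟨i + 1, h⟩ : Fin n) - MvPolynomial.X ⟨i, by omega⟩) * D i P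
        = P - MvPolynomial.rename (Equiv.swap (⟨i, by omega⟩ : Fin n) ⟨i + 1, h⟩) P) :
    (∃ f : NH n →+* SymEnd n,
      (∀ a : Fin n, f (RingQuot.mkRingHom (NRel n) (nX a)) = mulXEnd a) ∧
      (∀ (i : ℕ) (h : i + 1 < n),
        f (RingQuot.mkRingHom (NRel n) (nT i h)) = D i) ∧
      Function.Bijective f) ∧
    Nonempty (NH n ≃+* Matrix (Fin (Nat.factorial n)) (Fin (Nat.factorial n))
      ↥(MvPolynomial.symmetricSubalgebra (Fin n) ℤ)) := by
  have hD' : IsDemFamily fun i P => D i P := hD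
  obtain ⟨f, hfX, hfT⟩ := exists_polynomialRep hD'
  have H := nilHeckeFamily_seq n
  obtain ⟨ι, hι⟩ := exists_ringHom_X_eq (fun a : Fin n => xSeq n a) fun a b => H.x_comm a b
  have hιX : ∀ a : Fin n, ι (MvPolynomial.X a) = RingQuot.mkRingHom (NRel n) (nX a) :=
    fun a => (hι a).trans (xSeq_of_lt a.2)
  have hfι : ∀ p q, f (ι p) q = p * q := by
    intro p
    induction p using MvPolynomial.induction_on with
    | C c => intro q; rw [eq_intCast MvPolynomial.C c, map_intCast, map_intCast]; simp
    | add p p' hp hp' =>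
      intro q
      rw [map_add, map_add, LinearMap.add_apply, hp, hp', add_mul]
    | mul_X p a hp =>
      intro q
      rw [map_mul, map_mul, Module.End.mul_apply, hp, hιX, hfX, mul_assoc]
      rfl
  have hτ : ∀ (i : ℕ) (h : i + 1 < n),
      RingQuot.mkRingHom (NRel n) (nT i h) * longElt (tSeq n) n = 0 := fun i h => by
    rw [← tSeq_of_lt h, H.t_mul_longElt h]
  have hsym : ∀ p, (f (longElt (tSeq n) n) p).IsSymmetric := fun p =>
    isSymmetric_of_adjacent fun i h => hD'.rename_eq_of_apply_eq_zero h <| by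
      rw [← hfT i h, ← Module.End.mul_apply, ← map_mul, hτ, map_zero, LinearMap.zero_apply]
  have hkey : ∀ z p, z * ι p * longElt (tSeq n) n = ι (f z p) * longElt (tSeq n) n := by
    intro z
    obtain ⟨z, rfl⟩ := RingQuot.mkRingHom_surjective (NRel n) z
    induction z using FreeAlgebra.induction with
    | grade0 c =>
      intro p
      rw [eq_intCast (algebraMap ℤ (NF n)) c, map_intCast, map_intCast,
        ← map_intCast ι, ← map_mul]
      simp
    | grade1 g =>
      intro p
      cases g with
      | X a =>
        change RingQuot.mkRingHom (NRel n) (nX a) * ι p * _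
          = ι (f (RingQuot.mkRingHom (NRel n) (nX a)) p) * _
        rw [← hιX, hfι, map_mul]
      | T i h =>
        change RingQuot.mkRingHom (NRel n) (nT i h) * ι p * _
          = ι (f (RingQuot.mkRingHom (NRel n) (nT i h)) p) * _
        rw [hfT, ← tSeq_of_lt h,
          tSeq_mul_map hD' (fun i p q => map_add (D i) p q) hι h, add_mul, mul_assoc,
          H.t_mul_longElt h, mul_zero, zero_add]
    | mul u v hu hv =>
      intro p
      rw [map_mul, map_mul, Module.End.mul_apply, ← hu, mul_assoc _ _ (ι p), mul_assoc, hv,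
        mul_assoc]
    | add u v hu hv =>
      intro p
      rw [map_add, map_add, LinearMap.add_apply, map_add, add_mul, add_mul, add_mul, hu, hv]
  obtain ⟨K, _, a, b, hcard, hone, hind⟩ := H.exists_resolution ι hι le_rfl
  have hbij := bijective_of_resolution hfι hkey hsym hone
  obtain ⟨B⟩ := nonempty_basis_of_resolution hfι hsym hone hind
  let e : K ≃ Fin (Nat.factorial n) := Fintype.equivFinOfCardEq hcard
  exact ⟨⟨f, hfX, hfT, hbij⟩,
    ⟨(RingEquiv.ofBijective f hbij).trans (algEquivMatrix (B.reindex e)).toRingEquiv⟩⟩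
end
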